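/- Let a ≥ 0 and for each k ∈ ℕ set β_k := √((k+1/2)² + a). Then there exists a constant C > 0 such that for every t ∈ (0, π), all r₁, r₂ > 0 and every τ ∈ [−1,1], the kernel of the Schrödinger propagator satisfies (2 √(r₁ r₂) sin t)^{−1} · |Σ_{k=0}^∞ exp(−iπβ_k/2) · J_{β_k}( r₁ r₂ / (2 sin t) ) · ((2k+1)/(4π)) · P_k(τ)| ≤ C (sin t)^{−3/2}. (This is the pointwise dispersive bound |e^{−itH_{a,1}}(x,y)| ≤ C |sin t|^{−3/2} of Proposition 3.2, written for the explicit kernel with |x| = r₁, |y| = r₂, τ = (x/|x|)·(y/|y|); the omitted prefactor e^{−(r₁²+r₂²)/(4i tan t)} has modulus one.) -/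

import Mathlib

/-- The Bessel function of the first kind `J_ν(ρ)`, defined by its power series. -/
noncomputable def besselJ (ν ρ : ℝ) : ℝ :=
  ∑' m : ℕ, (-1 : ℝ) ^ m * (ρ / 2) ^ (2 * (m : ℝ) + ν) /
    ((m.factorial : ℝ) * Real.Gamma ((m : ℝ) + ν + 1))

/-- The degree-`k` Legendre polynomial. -/
noncomputable def legendreP (k : ℕ) (x : ℝ) : ℝ :=
  (1 / 2 ^ k : ℝ) * ∑ j ∈ Finset.range (k + 1),
    ((k.choose j : ℝ)) ^ 2 * (x - 1) ^ (k - j) * (x + 1) ^ j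

/-- `β_k = √((k+1/2)² + a)`. -/
noncomputable def betaCoef (a : ℝ) (k : ℕ) : ℝ :=
  Real.sqrt (((k : ℝ) + 1 / 2) ^ 2 + a)

section PartialWaves

open Complex MeasureTheory

lemma integral_exp_int_mul_I (n : ℤ) :
    ∫ φ in (0 : ℝ)..(2 * Real.pi), cexp (n * φ * I) = if n = 0 then 2 * (Real.pi : ℂ) else 0 := by
  split_ifs with h
  · subst h
    simp
  · have hn : (n : ℂ) * I ≠ 0 := mul_ne_zero (by exact_mod_cast h) I_ne_zero
    have : ∀ φ : ℝ, cexp (n * φ * I) = cexp (n * I * φ) := fun φ => by ring_nf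
    simp_rw [this]
    rw [integral_exp_mul_complex hn]
    have h2 : cexp (n * I * ((2 * Real.pi : ℝ) : ℂ)) = 1 := by
      rw [Complex.exp_eq_one_iff]
      exact ⟨n, by push_cast; ring⟩
    rw [h2]
    simp

/-- The integrand base of Laplace's integral for the Legendre polynomials. -/
noncomputable def laplaceBase (x φ : ℝ) : ℂ := x + I * √(1 - x ^ 2) * Real.cos φ

lemma laplaceBase_eq_mul {x : ℝ} (hx : x ∈ Set.Icc (-1 : ℝ) 1) (φ : ℝ) :
    laplaceBase x φ = ((√((1 + x) / 2) : ℝ) + I * √((1 - x) / 2) * cexp (φ * I)) *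
      ((√((1 + x) / 2) : ℝ) + I * √((1 - x) / 2) * cexp (-(φ * I))) := by
  obtain ⟨h1, h2⟩ := hx
  have hu : (√((1 + x) / 2)) ^ 2 = (1 + x) / 2 := Real.sq_sqrt (by linarith)
  have hv : (√((1 - x) / 2)) ^ 2 = (1 - x) / 2 := Real.sq_sqrt (by linarith)
  have hs : √(1 - x ^ 2) = 2 * √((1 + x) / 2) * √((1 - x) / 2) := by
    rw [mul_assoc, ← Real.sqrt_mul (by linarith), Real.sqrt_eq_iff_mul_self_eq (by nlinarith)
      (by positivity)]
    rw [mul_mul_mul_comm, Real.mul_self_sqrt (by nlinarith)]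
    ring
  have he : cexp (φ * I) * cexp (-(φ * I)) = 1 := by rw [← Complex.exp_add]; simp
  have hc : ((Real.cos φ : ℝ) : ℂ) = (cexp (φ * I) + cexp (-(φ * I))) / 2 := by
    rw [Complex.ofReal_cos, Complex.cos]
    ring_nf
  rw [laplaceBase, hs, hc]
  have hu' : ((√((1 + x) / 2) : ℝ) : ℂ) ^ 2 = (1 + x) / 2 := by exact_mod_cast hu
  have hv' : ((√((1 - x) / 2) : ℝ) : ℂ) ^ 2 = (1 - x) / 2 := by exact_mod_cast hv
  push_cast
  generalize ((√((1 + x) / 2) : ℝ) : ℂ) = u at *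
  generalize ((√((1 - x) / 2) : ℝ) : ℂ) = v at *
  linear_combination (-1) * hu' + hv' - v ^ 2 * I ^ 2 * he - v ^ 2 * I_sq

lemma norm_laplaceBase_le {x : ℝ} (hx : x ∈ Set.Icc (-1 : ℝ) 1) (φ : ℝ) :
    ‖laplaceBase x φ‖ ≤ 1 := by
  obtain ⟨h1, h2⟩ := hx
  have hs : (√(1 - x ^ 2)) ^ 2 = 1 - x ^ 2 := Real.sq_sqrt (by nlinarith)
  have : laplaceBase x φ = (x : ℝ) + ((√(1 - x ^ 2) * Real.cos φ : ℝ) : ℂ) * I := by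
    simp only [laplaceBase]; push_cast; ring
  rw [this, Complex.norm_add_mul_I, Real.sqrt_le_iff, mul_pow, hs]
  refine ⟨zero_le_one, ?_⟩
  nlinarith [Real.cos_sq_le_one φ, sq_nonneg x]

@[fun_prop]
lemma continuous_laplaceBase (x : ℝ) : Continuous (laplaceBase x) := by
  unfold laplaceBase; fun_prop

/-- Laplace's first integral for the Legendre polynomials. -/
lemma integral_laplaceBase_pow (k : ℕ) {x : ℝ} (hx : x ∈ Set.Icc (-1 : ℝ) 1) :
    ∫ φ in (0 : ℝ)..(2 * Real.pi), laplaceBase x φ ^ k = 2 * Real.pi * (legendreP k x : ℝ) := by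
  have hu : (√((1 + x) / 2)) ^ 2 = (1 + x) / 2 := Real.sq_sqrt (by linarith [hx.1])
  have hv : (√((1 - x) / 2)) ^ 2 = (1 - x) / 2 := Real.sq_sqrt (by linarith [hx.2])
  have hu' : ((√((1 + x) / 2) : ℝ) : ℂ) ^ 2 = (1 + x) / 2 := by exact_mod_cast hu
  have hv' : ((√((1 - x) / 2) : ℝ) : ℂ) ^ 2 = (1 - x) / 2 := by exact_mod_cast hv
  simp_rw [laplaceBase_eq_mul hx]
  generalize ((√((1 + x) / 2) : ℝ) : ℂ) = u at *
  generalize ((√((1 - x) / 2) : ℝ) : ℂ) = v at *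
  have hterm : ∀ φ : ℝ, ((u + I * v * cexp (φ * I)) * (u + I * v * cexp (-(φ * I)))) ^ k =
      ∑ j ∈ Finset.range (k + 1), ∑ l ∈ Finset.range (k + 1),
        (u ^ j * (I * v) ^ (k - j) * k.choose j * (u ^ l * (I * v) ^ (k - l) * k.choose l)) *
          cexp (((((k - j : ℕ) : ℤ) - ((k - l : ℕ) : ℤ) : ℤ) : ℂ) * φ * I) := by
    intro φ
    rw [mul_pow, add_pow, add_pow, Finset.sum_mul_sum]
    refine Finset.sum_congr rfl fun j _ => Finset.sum_congr rfl fun l _ => ?_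
    rw [mul_pow (I * v) (cexp _), mul_pow (I * v) (cexp _), ← Complex.exp_nat_mul,
      ← Complex.exp_nat_mul]
    have : cexp (((((k - j : ℕ) : ℤ) - ((k - l : ℕ) : ℤ) : ℤ) : ℂ) * φ * I) =
        cexp (((k - j : ℕ) : ℂ) * (φ * I)) * cexp (((k - l : ℕ) : ℂ) * -(φ * I)) := by
      rw [← Complex.exp_add]
      congr 1
      push_cast
      ring
    rw [this]
    ring
  simp_rw [hterm]
  rw [intervalIntegral.integral_finsetSum (fun j _ => by
    apply Continuous.intervalIntegrable; fun_prop)]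
  have : ∀ j ∈ Finset.range (k + 1), ∫ φ in (0 : ℝ)..(2 * Real.pi), ∑ l ∈ Finset.range (k + 1),
        (u ^ j * (I * v) ^ (k - j) * k.choose j * (u ^ l * (I * v) ^ (k - l) * k.choose l)) *
          cexp (((((k - j : ℕ) : ℤ) - ((k - l : ℕ) : ℤ) : ℤ) : ℂ) * φ * I) =
      2 * Real.pi * ((1 / 2 ^ k) * ((k.choose j) ^ 2 * (x - 1) ^ (k - j) * (x + 1) ^ j)) := by
    intro j hj
    rw [intervalIntegral.integral_finsetSum (fun j _ => by
      apply Continuous.intervalIntegrable; fun_prop)]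
    simp_rw [intervalIntegral.integral_const_mul, integral_exp_int_mul_I]
    rw [Finset.sum_eq_single j]
    · have hjk : j ≤ k := Nat.lt_succ_iff.mp (Finset.mem_range.mp hj)
      have e1 : (u ^ j * (I * v) ^ (k - j) * k.choose j * (u ^ j * (I * v) ^ (k - j) * k.choose j))
          = (k.choose j) ^ 2 * (u ^ 2) ^ j * (I ^ 2 * v ^ 2) ^ (k - j) := by
        rw [mul_pow (I ^ 2), mul_pow I v]
        ring
      have e2 : I ^ 2 * v ^ 2 = (x - 1) / 2 := by rw [hv', I_sq]; ring
      rw [e1, e2, hu', div_pow, div_pow]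
      have h2 : (2 : ℂ) ^ k = 2 ^ j * 2 ^ (k - j) := by rw [← pow_add]; congr 1; omega
      rw [h2]
      simp only [sub_self, if_true]
      field_simp
      ring
    · intro l hl hlj
      rw [if_neg, mul_zero]
      have h1 := Finset.mem_range.mp hj
      have h2 := Finset.mem_range.mp hl
      omega
    · exact fun h => absurd hj h
  rw [Finset.sum_congr rfl this, legendreP]
  push_cast
  rw [Finset.mul_sum, Finset.mul_sum]

lemma abs_legendreP_le_one (k : ℕ) {x : ℝ} (hx : x ∈ Set.Icc (-1 : ℝ) 1) :
    |legendreP k x| ≤ 1 := by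
  have h := intervalIntegral.norm_integral_le_of_norm_le_const (a := 0) (b := 2 * Real.pi)
    (f := fun φ => laplaceBase x φ ^ k) (C := 1) (fun φ _ => by
      rw [norm_pow]; exact pow_le_one₀ (norm_nonneg _) (norm_laplaceBase_le hx φ))
  have hpi := Real.pi_pos
  rw [integral_laplaceBase_pow k hx, norm_mul, Complex.norm_real, Real.norm_eq_abs, sub_zero,
    abs_of_pos (by positivity : 0 < 2 * Real.pi), one_mul] at h
  have h3 : ‖(2 * Real.pi : ℂ)‖ = 2 * Real.pi := by
    rw [norm_mul, Complex.norm_real, Real.norm_eq_abs, abs_of_pos hpi]; simp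
  rw [h3] at h
  nlinarith

lemma legendreP_recurrence (k : ℕ) {x : ℝ} (hx : x ∈ Set.Icc (-1 : ℝ) 1) :
    (2 * (k : ℝ) + 1) * x * legendreP k x =
      (k + 1) * legendreP (k + 1) x + k * legendreP (k - 1) x := by
  have hpi := Real.pi_pos
  have hs : ((√(1 - x ^ 2) : ℝ) : ℂ) ^ 2 = 1 - x ^ 2 := by
    exact_mod_cast Real.sq_sqrt (by nlinarith [hx.1, hx.2])
  have hd : ∀ φ : ℝ, HasDerivAt (laplaceBase x) (-(I * √(1 - x ^ 2) * Real.sin φ)) φ := by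
    intro φ
    have := (((Real.hasDerivAt_cos φ).ofReal_comp).const_mul (I * √(1 - x ^ 2))).const_add (x : ℂ)
    refine this.congr_deriv ?_
    push_cast; ring
  have hd2 : ∀ φ : ℝ, HasDerivAt (fun φ : ℝ => -(I * √(1 - x ^ 2) * Real.sin φ))
      (-(I * √(1 - x ^ 2) * Real.cos φ)) φ := by
    intro φ
    exact (((Real.hasDerivAt_sin φ).ofReal_comp).const_mul (I * √(1 - x ^ 2))).neg
  have hD : ∀ φ : ℝ, HasDerivAt (fun φ : ℝ => laplaceBase x φ ^ k *
      (-(I * √(1 - x ^ 2) * Real.sin φ)))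
      ((2 * k + 1) * x * laplaceBase x φ ^ k -
        (k + 1) * laplaceBase x φ ^ (k + 1) - k * laplaceBase x φ ^ (k - 1)) φ := by
    intro φ
    refine (((hd φ).fun_pow k).mul (hd2 φ)).congr_deriv ?_
    have hsc : ((Real.sin φ : ℝ) : ℂ) ^ 2 + ((Real.cos φ : ℝ) : ℂ) ^ 2 = 1 := by
      exact_mod_cast Real.sin_sq_add_cos_sq φ
    have hZ : I * √(1 - x ^ 2) * Real.cos φ = laplaceBase x φ - x := by
      simp [laplaceBase]
    have hZ2 : (I * √(1 - x ^ 2) * Real.sin φ) ^ 2 =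
        -(laplaceBase x φ ^ 2 - 2 * x * laplaceBase x φ + 1) := by
      have e : (laplaceBase x φ - x) ^ 2 = -((1 - x ^ 2) * ((Real.cos φ : ℝ) : ℂ) ^ 2) := by
        rw [← hZ, mul_pow, mul_pow, hs, I_sq]; ring
      rw [mul_pow, mul_pow, hs, I_sq]
      linear_combination (-(1 - (x : ℂ) ^ 2)) * hsc + e
    generalize laplaceBase x φ = Z at *
    rw [hZ]
    rcases k with _ | k
    · simp
    · simp only [Nat.add_sub_cancel]
      push_cast
      push_cast at hZ2
      linear_combination ((k + 1 : ℂ) * Z ^ k) * hZ2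
  have h0 := intervalIntegral.integral_eq_sub_of_hasDerivAt (a := 0) (b := 2 * Real.pi)
    (fun φ _ => hD φ) (by apply Continuous.intervalIntegrable; fun_prop)
  rw [intervalIntegral.integral_sub, intervalIntegral.integral_sub,
    intervalIntegral.integral_const_mul, intervalIntegral.integral_const_mul,
    intervalIntegral.integral_const_mul, integral_laplaceBase_pow _ hx,
    integral_laplaceBase_pow _ hx, integral_laplaceBase_pow _ hx] at h0
  · simp only [Real.sin_two_pi, Real.sin_zero, Complex.ofReal_zero, mul_zero, neg_zero,
      sub_zero] at h0
    have hpi' : (2 * Real.pi : ℂ) ≠ 0 := by exact_mod_cast (by positivity : 2 * Real.pi ≠ 0)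
    have : (2 * (k : ℂ) + 1) * x * legendreP k x =
      (k + 1) * legendreP (k + 1) x + k * legendreP (k - 1) x := by
      apply mul_left_cancel₀ hpi'
      linear_combination h0
    exact_mod_cast this
  all_goals apply Continuous.intervalIntegrable; fun_prop

/-- The pairs `(k, m)` with `k + 2 m = n`. -/
def weightedFiber (n : ℕ) : Finset (ℕ × ℕ) :=
  ((Finset.range (n + 1)) ×ˢ (Finset.range (n + 1))).filter fun p => p.1 + 2 * p.2 = n

lemma mem_weightedFiber {n : ℕ} {p : ℕ × ℕ} : p ∈ weightedFiber n ↔ p.1 + 2 * p.2 = n := by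
  simp only [weightedFiber, Finset.mem_filter, Finset.mem_product, Finset.mem_range]
  omega

lemma sum_weightedFiber_shift_left {f : ℕ × ℕ → ℝ} (hf : ∀ m, f (0, m) = 0) (n : ℕ) :
    ∑ p ∈ weightedFiber n, f (p.1 + 1, p.2) = ∑ p ∈ weightedFiber (n + 1), f p := by
  refine Finset.sum_of_injOn (fun p : ℕ × ℕ => (p.1 + 1, p.2)) ?_ ?_ ?_ fun _ _ => rfl
  · rintro ⟨a, b⟩ - ⟨c, d⟩ - h
    simpa using h
  · rintro p hp
    rw [Finset.mem_coe, mem_weightedFiber] at *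
    dsimp only
    omega
  · rintro ⟨k, m⟩ hp h
    rcases k with _ | k
    · exact hf m
    · refine absurd ⟨(k, m), ?_, rfl⟩ h
      rw [Finset.mem_coe]
      rw [mem_weightedFiber] at *
      dsimp only at *
      omega

lemma sum_weightedFiber_shift_right {f : ℕ × ℕ → ℝ} (hf : ∀ k, f (k, 0) = 0) (n : ℕ) :
    ∑ p ∈ weightedFiber n, f (p.1, p.2 + 1) = ∑ p ∈ weightedFiber (n + 2), f p := by
  refine Finset.sum_of_injOn (fun p : ℕ × ℕ => (p.1, p.2 + 1)) ?_ ?_ ?_ fun _ _ => rfl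
  · rintro ⟨a, b⟩ - ⟨c, d⟩ - h
    simpa using h
  · rintro p hp
    rw [Finset.mem_coe, mem_weightedFiber] at *
    dsimp only
    omega
  · rintro ⟨k, m⟩ hp h
    rcases m with _ | m
    · exact hf k
    · refine absurd ⟨(k, m), ?_, rfl⟩ h
      rw [Finset.mem_coe]
      rw [mem_weightedFiber] at *
      dsimp only at *
      omega

/-- The coefficient of `P_k` in the expansion of a multiple of the monomial of degree `k + 2 m`. -/
noncomputable def monomialCoeff (p : ℕ × ℕ) : ℝ :=
  (p.2.factorial * Real.Gamma (p.2 + p.1 + 3 / 2))⁻¹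

lemma monomialCoeff_step_left (k m : ℕ) :
    monomialCoeff (k, m) = (m + k + 3 / 2) * monomialCoeff (k + 1, m) := by
  have h0 : (m + k + 3 / 2 : ℝ) ≠ 0 := by positivity
  have := Real.Gamma_add_one h0
  have hG : Real.Gamma (m + k + 3 / 2) ≠ 0 := (Real.Gamma_pos_of_pos (by positivity)).ne'
  simp only [monomialCoeff]
  push_cast
  rw [show (m + (k + 1) + 3 / 2 : ℝ) = m + k + 3 / 2 + 1 by ring, this]
  field_simp

lemma monomialCoeff_step_right (k m : ℕ) :
    monomialCoeff (k + 1, m) = (m + 1) * monomialCoeff (k, m + 1) := by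
  have hG : Real.Gamma (m + (k + 1) + 3 / 2) ≠ 0 := (Real.Gamma_pos_of_pos (by positivity)).ne'
  simp only [monomialCoeff, Nat.factorial_succ]
  push_cast
  rw [show (m + 1 + k + 3 / 2 : ℝ) = m + (k + 1) + 3 / 2 by ring]
  field_simp

lemma sum_weightedFiber_succ {x : ℝ} (hx : x ∈ Set.Icc (-1 : ℝ) 1) (n : ℕ) :
    (n + 1) * ∑ p ∈ weightedFiber (n + 1), (2 * (p.1 : ℝ) + 1) * monomialCoeff p * legendreP p.1 x =
      2 * x * ∑ p ∈ weightedFiber n, (2 * (p.1 : ℝ) + 1) * monomialCoeff p * legendreP p.1 x := by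
  have hsplit : (n + 1) * ∑ p ∈ weightedFiber (n + 1),
        (2 * (p.1 : ℝ) + 1) * monomialCoeff p * legendreP p.1 x =
      ∑ p ∈ weightedFiber (n + 1), (2 * (p.1 : ℝ)) * (p.2 + p.1 + 1 / 2) * monomialCoeff p *
          legendreP p.1 x +
        ∑ p ∈ weightedFiber (n + 1), (2 * ((p.1 : ℝ) + 1)) * p.2 * monomialCoeff p *
          legendreP p.1 x := by
    rw [Finset.mul_sum, ← Finset.sum_add_distrib]
    refine Finset.sum_congr rfl fun p hp => ?_
    have : (p.1 : ℝ) + 2 * p.2 = n + 1 := by exact_mod_cast mem_weightedFiber.mp hp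
    rw [← this]
    ring
  have hrec : 2 * x * ∑ p ∈ weightedFiber n, (2 * (p.1 : ℝ) + 1) * monomialCoeff p *
        legendreP p.1 x =
      ∑ p ∈ weightedFiber n, 2 * ((p.1 : ℝ) + 1) * monomialCoeff p * legendreP (p.1 + 1) x +
        ∑ p ∈ weightedFiber n, 2 * (p.1 : ℝ) * monomialCoeff p * legendreP (p.1 - 1) x := by
    rw [Finset.mul_sum, ← Finset.sum_add_distrib]
    refine Finset.sum_congr rfl fun p _ => ?_
    linear_combination 2 * monomialCoeff p * legendreP_recurrence p.1 hx
  rw [hsplit, hrec]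
  congr 1
  · rw [← sum_weightedFiber_shift_left (by simp)]
    refine Finset.sum_congr rfl fun p _ => ?_
    rw [show monomialCoeff p = _ from monomialCoeff_step_left p.1 p.2]
    push_cast
    ring
  · rcases n with _ | n
    · have h1 : weightedFiber 1 = {(1, 0)} := by decide
      have h0 : weightedFiber 0 = {(0, 0)} := by decide
      simp [h0, h1]
    · rw [← sum_weightedFiber_shift_right (by simp), ← sum_weightedFiber_shift_left (by simp)]
      refine Finset.sum_congr rfl fun p _ => ?_
      simp only [monomialCoeff_step_right, Nat.add_sub_cancel]
      push_cast
      ring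

/-- Expansion of monomials in Legendre polynomials. -/
lemma sum_weightedFiber_eq {x : ℝ} (hx : x ∈ Set.Icc (-1 : ℝ) 1) (n : ℕ) :
    ∑ p ∈ weightedFiber n, (2 * (p.1 : ℝ) + 1) * monomialCoeff p * legendreP p.1 x =
      (Real.Gamma (3 / 2))⁻¹ * ((2 * x) ^ n / n.factorial) := by
  induction n with
  | zero =>
    have h0 : weightedFiber 0 = {(0, 0)} := by decide
    simp [h0, monomialCoeff, legendreP]
  | succ n ih =>
    have h := sum_weightedFiber_succ hx n
    have hn : (n + 1 : ℝ) ≠ 0 := by positivity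
    apply mul_left_cancel₀ hn
    rw [h, ih, Nat.factorial_succ]
    push_cast
    rw [pow_succ']
    field_simp

lemma Gamma_mul_pow_le {s : ℝ} (hs : 0 < s) (m : ℕ) :
    Real.Gamma s * s ^ m ≤ Real.Gamma (m + s) := by
  induction m with
  | zero => simp
  | succ m ih =>
    have h0 : (m + s : ℝ) ≠ 0 := by positivity
    have hG := Real.Gamma_pos_of_pos hs
    push_cast
    rw [show (m + 1 + s : ℝ) = m + s + 1 by ring, Real.Gamma_add_one h0, pow_succ]
    calc Real.Gamma s * (s ^ m * s) = s * (Real.Gamma s * s ^ m) := by ring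
      _ ≤ (m + s) * Real.Gamma (m + s) := by
        apply mul_le_mul _ ih (by positivity) (by positivity)
        have : (0 : ℝ) ≤ m := by positivity
        linarith

lemma Gamma_mul_factorial_le (k : ℕ) :
    Real.Gamma (3 / 2) * k.factorial ≤ Real.Gamma (k + 3 / 2) := by
  induction k with
  | zero => simp
  | succ k ih =>
    have h0 : (k + 3 / 2 : ℝ) ≠ 0 := by positivity
    have hG : 0 < Real.Gamma (3 / 2) := Real.Gamma_pos_of_pos (by norm_num)
    push_cast [Nat.factorial_succ]
    rw [show (k + 1 + 3 / 2 : ℝ) = k + 3 / 2 + 1 by ring, Real.Gamma_add_one h0]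
    calc Real.Gamma (3 / 2) * ((k + 1) * k.factorial)
        = (k + 1) * (Real.Gamma (3 / 2) * k.factorial) := by ring
      _ ≤ (k + 3 / 2) * Real.Gamma (k + 3 / 2) := by
        apply mul_le_mul _ ih (by positivity) (by positivity)
        linarith

lemma monomialCoeff_le (p : ℕ × ℕ) :
    monomialCoeff p ≤ (Real.Gamma (3 / 2))⁻¹ * ((p.1.factorial : ℝ)⁻¹ * (p.2.factorial : ℝ)⁻¹) := by
  have hG : 0 < Real.Gamma (3 / 2) := Real.Gamma_pos_of_pos (by norm_num)
  have h1 := Gamma_mul_pow_le (s := p.1 + 3 / 2) (by positivity) p.2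
  have h2 := Gamma_mul_factorial_le p.1
  have hG' : 0 < Real.Gamma (p.1 + 3 / 2) := Real.Gamma_pos_of_pos (by positivity)
  have h3 : (1 : ℝ) ≤ (p.1 + 3 / 2) ^ p.2 := by
    apply one_le_pow₀
    have : (0 : ℝ) ≤ p.1 := by positivity
    linarith
  rw [monomialCoeff, ← mul_inv, ← mul_inv]
  apply inv_anti₀ (by positivity)
  rw [show Real.Gamma (3 / 2) * (p.1.factorial * p.2.factorial : ℝ) =
    p.2.factorial * (Real.Gamma (3 / 2) * p.1.factorial) by ring, add_assoc]
  gcongr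
  nlinarith

lemma two_mul_add_one_le_three_pow (k : ℕ) : (2 * (k : ℝ) + 1) ≤ 3 ^ k := by
  have := one_add_mul_le_pow (a := (2 : ℝ)) (by norm_num) k
  norm_num at this
  linarith

lemma monomialCoeff_nonneg (p : ℕ × ℕ) : 0 ≤ monomialCoeff p := by
  unfold monomialCoeff
  have := Real.Gamma_pos_of_pos (s := p.2 + p.1 + 3 / 2) (by positivity)
  positivity

/-- The general term of the double series behind the plane wave expansion. -/
noncomputable def planeWaveTerm (x R : ℝ) (p : ℕ × ℕ) : ℂ :=
  (((2 * (p.1 : ℝ) + 1) * monomialCoeff p * legendreP p.1 x : ℝ) : ℂ) *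
    (-I * R) ^ (p.1 + 2 * p.2)

lemma summable_planeWaveTerm {x R : ℝ} (hx : x ∈ Set.Icc (-1 : ℝ) 1) (hR : 0 < R) :
    Summable (planeWaveTerm x R) := by
  have hG : 0 < Real.Gamma (3 / 2) := Real.Gamma_pos_of_pos (by norm_num)
  have h1 := ((Real.summable_pow_div_factorial (3 * R)).mul_of_nonneg
    (Real.summable_pow_div_factorial (R ^ 2)) (fun _ => by positivity)
    (fun _ => by positivity)).mul_left (Real.Gamma (3 / 2))⁻¹
  refine Summable.of_norm_bounded h1 fun p => ?_
  have hc := monomialCoeff_nonneg p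
  have hnorm : ‖-I * (R : ℂ)‖ = R := by
    rw [norm_mul, norm_neg, Complex.norm_I, one_mul, Complex.norm_real, Real.norm_eq_abs,
      abs_of_pos hR]
  rw [planeWaveTerm, norm_mul, Complex.norm_real, norm_pow, hnorm, Real.norm_eq_abs, abs_mul,
    abs_of_nonneg (mul_nonneg (by positivity) hc)]
  calc (2 * (p.1 : ℝ) + 1) * monomialCoeff p * |legendreP p.1 x| * R ^ (p.1 + 2 * p.2)
      ≤ 3 ^ p.1 * ((Real.Gamma (3 / 2))⁻¹ * ((p.1.factorial : ℝ)⁻¹ * (p.2.factorial : ℝ)⁻¹)) * 1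
        * R ^ (p.1 + 2 * p.2) := by
        gcongr
        · exact two_mul_add_one_le_three_pow _
        · exact monomialCoeff_le p
        · exact abs_legendreP_le_one _ hx
    _ = _ := by
      rw [pow_add, pow_mul, mul_pow]
      field_simp

lemma sum_weightedFiber_planeWaveTerm {x : ℝ} (R : ℝ) (hx : x ∈ Set.Icc (-1 : ℝ) 1) (n : ℕ) :
    ∑ p ∈ weightedFiber n, planeWaveTerm x R p =
      ((Real.Gamma (3 / 2))⁻¹ : ℝ) * ((-I * R * (2 * x)) ^ n / n.factorial) := by
  have : ∀ p ∈ weightedFiber n, planeWaveTerm x R p =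
      (((2 * (p.1 : ℝ) + 1) * monomialCoeff p * legendreP p.1 x : ℝ) : ℂ) * (-I * R) ^ n :=
    fun p hp => by rw [planeWaveTerm, mem_weightedFiber.mp hp]
  rw [Finset.sum_congr rfl this, ← Finset.sum_mul, ← Complex.ofReal_sum, sum_weightedFiber_eq hx,
    mul_pow (-I * (R : ℂ))]
  push_cast
  ring

lemma hasSum_cexp (z : ℂ) : HasSum (fun n : ℕ => z ^ n / n.factorial) (cexp z) := by
  rw [Complex.exp_eq_exp_ℂ]
  exact NormedSpace.expSeries_div_hasSum_exp z

/-- The double series behind the plane wave expansion. -/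
lemma hasSum_planeWaveTerm {x R : ℝ} (hx : x ∈ Set.Icc (-1 : ℝ) 1) (hR : 0 < R) :
    HasSum (planeWaveTerm x R)
      (((Real.Gamma (3 / 2))⁻¹ : ℝ) * cexp (-I * R * (2 * x))) := by
  have hsum := (summable_planeWaveTerm hx hR).hasSum
  have hfib := hsum.tsum_fiberwise (fun p => p.1 + 2 * p.2)
  have hval : ∀ n : ℕ, ∑' b : ((fun p : ℕ × ℕ => p.1 + 2 * p.2) ⁻¹' {n}), planeWaveTerm x R b =
      ((Real.Gamma (3 / 2))⁻¹ : ℝ) * ((-I * R * (2 * x)) ^ n / n.factorial) := by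
    intro n
    have hset : ((fun p : ℕ × ℕ => p.1 + 2 * p.2) ⁻¹' {n}) = (weightedFiber n : Set (ℕ × ℕ)) := by
      ext p
      simp [mem_weightedFiber]
    rw [hset, Finset.tsum_subtype', sum_weightedFiber_planeWaveTerm R hx]
  simp_rw [hval] at hfib
  have hexp : HasSum (fun n : ℕ => (((Real.Gamma (3 / 2))⁻¹ : ℝ) : ℂ) *
      ((-I * R * (2 * x)) ^ n / n.factorial))
      (((Real.Gamma (3 / 2))⁻¹ : ℝ) * cexp (-I * R * (2 * x))) := by
    exact (hasSum_cexp _).mul_left _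
  rwa [hfib.unique hexp] at hsum

lemma norm_cexp_mul_I' (x y : ℝ) : ‖cexp (x * y * I)‖ = 1 := by
  have := Complex.norm_exp_ofReal_mul_I (x * y)
  push_cast at this
  exact this

/-- The arc part of Hankel's contour integral. -/
noncomputable def arcIntegral (R s : ℝ) : ℂ :=
  ∫ θ in (-Real.pi)..Real.pi, cexp (R * cexp (θ * I)) * cexp (s * θ * I)

lemma hasSum_arcIntegral {R : ℝ} (hR : 0 < R) (s : ℝ) :
    HasSum (fun n : ℕ => (R : ℂ) ^ n / n.factorial *
      ∫ θ in (-Real.pi)..Real.pi, cexp (((n + s : ℝ) : ℂ) * θ * I)) (arcIntegral R s) := by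
  simp_rw [← intervalIntegral.integral_const_mul]
  refine intervalIntegral.hasSum_integral_of_dominated_convergence
    (fun n _ => R ^ n / n.factorial) (fun n => ?_) (fun n => ?_) ?_ ?_ ?_
  · apply Continuous.aestronglyMeasurable
    fun_prop
  · refine Filter.Eventually.of_forall fun θ _ => ?_
    rw [norm_mul, norm_cexp_mul_I', mul_one]
    simp [abs_of_pos hR]
  · exact Filter.Eventually.of_forall fun _ _ => Real.summable_pow_div_factorial R
  · exact intervalIntegrable_const
  · refine Filter.Eventually.of_forall fun θ _ => ?_
    have := (hasSum_cexp (R * cexp (θ * I))).mul_right (cexp (s * θ * I))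
    have e : (fun n : ℕ => (R : ℂ) ^ n / n.factorial * cexp (((n + s : ℝ) : ℂ) * θ * I)) =
        fun n : ℕ => (R * cexp (θ * I)) ^ n / n.factorial * cexp (s * θ * I) := by
      funext n
      rw [mul_pow, ← Complex.exp_nat_mul, mul_div_right_comm, mul_assoc (_ / _),
        ← Complex.exp_add]
      congr 2
      push_cast
      ring
    rw [e]
    exact this

lemma integral_cexp_symm {w : ℝ} (hw : w ≠ 0) :
    ∫ θ in (-Real.pi)..Real.pi, cexp (w * θ * I) = ((2 * Real.sin (Real.pi * w) / w : ℝ) : ℂ) := by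
  have hw' : (w : ℂ) ≠ 0 := by exact_mod_cast hw
  have : ∀ θ : ℝ, cexp (w * θ * I) = cexp (w * I * θ) := fun θ => by ring_nf
  simp_rw [this]
  rw [integral_exp_mul_complex (mul_ne_zero hw' I_ne_zero)]
  push_cast
  rw [Complex.sin]
  field_simp
  rw [I_sq]
  ring_nf

lemma arcIntegral_zero {R : ℝ} (hR : 0 < R) : arcIntegral R 0 = 2 * Real.pi := by
  refine (hasSum_arcIntegral hR 0).unique ?_
  convert hasSum_single (f := fun n : ℕ => (R : ℂ) ^ n / n.factorial *
      ∫ θ in (-Real.pi)..Real.pi, cexp (((n + 0 : ℝ) : ℂ) * θ * I)) 0 ?_ using 1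
  · simp
    ring
  · intro n hn
    rw [integral_cexp_symm (by simpa using hn), add_zero, mul_comm Real.pi, Real.sin_nat_mul_pi]
    simp

lemma arcIntegral_of_pos {R s : ℝ} (hR : 0 < R) (hs : 0 < s) :
    arcIntegral R s = ((2 * Real.sin (Real.pi * s) * R ^ (-s) *
      ∫ t in (0 : ℝ)..R, Real.exp (-t) * t ^ (s - 1) : ℝ) : ℂ) := by
  refine (hasSum_arcIntegral hR s).unique ?_
  have h : HasSum (fun n : ℕ => ∫ t in (0 : ℝ)..R, (-t) ^ n / n.factorial * t ^ (s - 1))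
      (∫ t in (0 : ℝ)..R, Real.exp (-t) * t ^ (s - 1)) := by
    have hint : IntervalIntegrable (fun t : ℝ => t ^ (s - 1)) volume 0 R :=
      intervalIntegral.intervalIntegrable_rpow' (by linarith)
    refine intervalIntegral.hasSum_integral_of_dominated_convergence
      (fun n t => t ^ n / n.factorial * t ^ (s - 1)) (fun n => ?_) (fun n => ?_) ?_ ?_ ?_
    · apply Measurable.aestronglyMeasurable
      fun_prop
    · refine Filter.Eventually.of_forall fun t ht => ?_
      rw [Set.uIoc_of_le hR.le] at ht
      have := ht.1
      simp only [norm_mul, norm_div, norm_pow, norm_neg, Real.norm_eq_abs, Nat.abs_cast,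
        abs_of_pos this, abs_of_nonneg (Real.rpow_nonneg this.le _)]
      rfl
    · exact Filter.Eventually.of_forall fun t _ =>
        (Real.summable_pow_div_factorial t).mul_right _
    · have : ∀ t : ℝ, ∑' n : ℕ, t ^ n / n.factorial * t ^ (s - 1) = Real.exp t * t ^ (s - 1) := by
        intro t
        rw [tsum_mul_right, Real.exp_eq_exp_ℝ, NormedSpace.exp_eq_tsum_div]
      simp_rw [this]
      exact hint.continuousOn_mul (by fun_prop)
    · refine Filter.Eventually.of_forall fun t _ => HasSum.mul_right _ ?_
      rw [Real.exp_eq_exp_ℝ]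
      exact NormedSpace.expSeries_div_hasSum_exp (-t)
  have h2 := (h.mul_left (2 * Real.sin (Real.pi * s) * R ^ (-s)))
  rw [← Complex.hasSum_ofReal] at h2
  convert h2 using 2 with n
  have hns : (n + s : ℝ) ≠ 0 := by positivity
  rw [integral_cexp_symm hns]
  have hint : ∫ t in (0 : ℝ)..R, (-t) ^ n / n.factorial * t ^ (s - 1) =
      (-1) ^ n / n.factorial * (R ^ (n + s) / (n + s)) := by
    have e : ∀ t ∈ Set.uIoc 0 R, (-t) ^ n / n.factorial * t ^ (s - 1) =
        (-1) ^ n / n.factorial * t ^ (n + s - 1) := by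
      intro t ht
      rw [Set.uIoc_of_le hR.le] at ht
      rw [add_sub_assoc, Real.rpow_add ht.1, Real.rpow_natCast, neg_pow]
      ring
    rw [intervalIntegral.integral_congr_ae (Filter.Eventually.of_forall e),
      intervalIntegral.integral_const_mul, integral_rpow (Or.inl (by
        have : (0 : ℝ) ≤ n := by positivity
        linarith)), sub_add_cancel, Real.zero_rpow hns, sub_zero]
  rw [hint]
  have hsin : Real.sin (Real.pi * (n + s)) = (-1) ^ n * Real.sin (Real.pi * s) := by
    rw [mul_add, add_comm, mul_comm Real.pi (n : ℝ), Real.sin_add_nat_mul_pi]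
  have hRR : R ^ (-s) * R ^ (n + s) = R ^ n := by
    rw [← Real.rpow_add hR, ← Real.rpow_natCast]
    congr 1
    ring
  have hRRc : (R : ℂ) ^ n = (R ^ (-s) : ℝ) * (R ^ (n + s) : ℝ) := by
    rw [← Complex.ofReal_mul, hRR, Complex.ofReal_pow]
  rw [hsin, hRRc]
  push_cast
  field_simp

lemma integrableOn_exp_neg_mul_rpow {R z : ℝ} (hR : 0 < R) (hz : 0 ≤ z) :
    IntegrableOn (fun t : ℝ => Real.exp (-t) * t ^ (-z)) (Set.Ioi R) := by
  have h := (integrableOn_exp_neg_Ioi R).mul_const (R ^ (-z))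
  refine Integrable.mono' h (by apply Measurable.aestronglyMeasurable; fun_prop) ?_
  refine (ae_restrict_iff' measurableSet_Ioi).mpr (Filter.Eventually.of_forall fun t ht => ?_)
  have ht' : R < t := ht
  have ht0 : 0 < t := hR.trans ht'
  rw [Real.norm_eq_abs, abs_of_nonneg (by positivity)]
  exact mul_le_mul_of_nonneg_left (Real.rpow_le_rpow_of_nonpos hR ht'.le (by linarith))
    (Real.exp_pos _).le

/-- The two rays of Hankel's contour integral. -/
noncomputable def rayIntegral (R z : ℝ) : ℝ :=
  ∫ t in Set.Ioi R, Real.exp (-t) * t ^ (-z)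

lemma rayIntegral_eq {R z : ℝ} (hR : 0 < R) (hz : 0 ≤ z) :
    rayIntegral R z = Real.exp (-R) * R ^ (-z) - z * rayIntegral R (z + 1) := by
  have hd : ∀ t ∈ Set.Ici R, HasDerivAt (fun t : ℝ => Real.exp (-t) * t ^ (-z))
      (-(Real.exp (-t) * t ^ (-z)) - z * (Real.exp (-t) * t ^ (-(z + 1)))) t := by
    intro t ht
    have ht0 : 0 < t := hR.trans_le ht
    have h1 : HasDerivAt (fun t : ℝ => Real.exp (-t)) (-Real.exp (-t)) t := by
      simpa using (hasDerivAt_neg t).exp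
    refine (h1.mul (Real.hasDerivAt_rpow_const (p := -z) (Or.inl ht0.ne'))).congr_deriv ?_
    rw [show -(z + 1) = -z - 1 by ring]
    ring
  have hi1 := integrableOn_exp_neg_mul_rpow hR hz
  have hi2 := integrableOn_exp_neg_mul_rpow hR (z := z + 1) (by linarith)
  have hlim : Filter.Tendsto (fun t : ℝ => Real.exp (-t) * t ^ (-z)) Filter.atTop (nhds 0) := by
    have := tendsto_rpow_mul_exp_neg_mul_atTop_nhds_zero (-z) 1 one_pos
    refine this.congr fun t => ?_
    rw [mul_comm]
    congr 2
    ring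
  have h := integral_Ioi_of_hasDerivAt_of_tendsto' hd (hi1.neg.sub (hi2.const_mul z)) hlim
  have h2 : ∫ t in Set.Ioi R, (-(Real.exp (-t) * t ^ (-z)) - z * (Real.exp (-t) * t ^ (-(z + 1)))) =
      -rayIntegral R z - z * rayIntegral R (z + 1) := by
    have hi1' : Integrable (fun t : ℝ => -(Real.exp (-t) * t ^ (-z)))
      (volume.restrict (Set.Ioi R)) := hi1.neg
    rw [integral_sub hi1' (hi2.const_mul z), integral_neg, integral_const_mul]
    rfl
  rw [h2] at h
  linarith

lemma arcIntegral_one_sub (R z : ℝ) :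
    R * arcIntegral R (1 - z) =
      z * arcIntegral R (-z) - 2 * (Real.sin (Real.pi * z) * Real.exp (-R) : ℝ) := by
  have hd : ∀ θ ∈ Set.uIcc (-Real.pi) Real.pi, HasDerivAt
      (fun θ : ℝ => cexp (R * cexp (θ * I)) * cexp ((-z : ℝ) * θ * I))
      (R * I * (cexp (R * cexp (θ * I)) * cexp ((1 - z : ℝ) * θ * I)) -
        z * I * (cexp (R * cexp (θ * I)) * cexp ((-z : ℝ) * θ * I))) θ := by
    intro θ _
    have hθ : HasDerivAt (fun θ : ℝ => (θ : ℂ)) 1 θ := Complex.ofRealCLM.hasDerivAt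
    have h1 := ((hθ.mul_const I).cexp.const_mul (R : ℂ)).cexp
    have h2 := ((hθ.const_mul ((-z : ℝ) : ℂ)).mul_const I).cexp
    refine (h1.mul h2).congr_deriv ?_
    have : cexp ((1 - z : ℝ) * θ * I) = cexp (θ * I) * cexp ((-z : ℝ) * θ * I) := by
      rw [← Complex.exp_add]
      congr 1
      push_cast
      ring
    rw [this]
    push_cast
    ring
  have h := intervalIntegral.integral_eq_sub_of_hasDerivAt hd
    (by apply Continuous.intervalIntegrable; fun_prop)
  rw [intervalIntegral.integral_sub (by apply Continuous.intervalIntegrable; fun_prop)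
    (by apply Continuous.intervalIntegrable; fun_prop), intervalIntegral.integral_const_mul,
    intervalIntegral.integral_const_mul] at h
  change R * I * arcIntegral R (1 - z) - z * I * arcIntegral R (-z) = _ at h
  have e1 : cexp (Real.pi * I) = -1 := Complex.exp_pi_mul_I
  have e2 : cexp ((-Real.pi : ℝ) * I) = -1 := by
    push_cast
    rw [neg_mul, Complex.exp_neg, e1]
    norm_num
  rw [e1, e2] at h
  have e3 : cexp ((-z : ℝ) * Real.pi * I) - cexp ((-z : ℝ) * (-Real.pi : ℝ) * I) =
      -2 * I * (Real.sin (Real.pi * z) : ℝ) := by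
    push_cast
    rw [Complex.sin]
    ring_nf
    rw [I_sq]
    ring
  have e4 : cexp (R * -1) = (Real.exp (-R) : ℝ) := by push_cast; congr 1; ring
  rw [← mul_sub, e3, e4] at h
  apply mul_left_cancel₀ I_ne_zero
  rw [Complex.ofReal_mul]
  linear_combination h

/-- Hankel's integral for the reciprocal Gamma function. -/
lemma Gamma_inv_eq_hankel {R : ℝ} (hR : 0 < R) {z : ℝ} (hz : 0 < z) :
    (((Real.Gamma z)⁻¹ : ℝ) : ℂ) = (R ^ (1 - z) / (2 * Real.pi) : ℝ) * arcIntegral R (1 - z) +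
      (Real.sin (Real.pi * z) / Real.pi * rayIntegral R z : ℝ) := by
  have hpi := Real.pi_pos
  have hpi' : (Real.pi : ℂ) ≠ 0 := by exact_mod_cast hpi.ne'
  have step : ∀ w : ℝ, 0 < w → ((((Real.Gamma w)⁻¹ : ℝ) : ℂ) =
      (R ^ (1 - w) / (2 * Real.pi) : ℝ) * arcIntegral R (1 - w) +
      (Real.sin (Real.pi * w) / Real.pi * rayIntegral R w : ℝ)) →
      ((((Real.Gamma (w + 1))⁻¹ : ℝ) : ℂ) =
      (R ^ (1 - (w + 1)) / (2 * Real.pi) : ℝ) * arcIntegral R (1 - (w + 1)) +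
      (Real.sin (Real.pi * (w + 1)) / Real.pi * rayIntegral R (w + 1) : ℝ)) := by
    intro w hw h
    have hw' : (w : ℂ) ≠ 0 := by exact_mod_cast hw.ne'
    have hsin : Real.sin (Real.pi * (w + 1)) = - Real.sin (Real.pi * w) := by
      rw [mul_add, mul_one, Real.sin_add_pi]
    have hRw : R ^ (1 - w) = R * R ^ (-w) := by
      rw [sub_eq_add_neg, Real.rpow_add hR, Real.rpow_one]
    have ha := arcIntegral_one_sub R w
    rw [Real.Gamma_add_one hw.ne', hsin, show 1 - (w + 1) = -w by ring, mul_inv]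
    apply mul_left_cancel₀ hw'
    rw [rayIntegral_eq hR hw.le, hRw] at h
    push_cast at h ha ⊢
    rw [mul_inv_cancel_left₀ hw', h]
    field_simp
    linear_combination ((R ^ (-w) : ℝ) : ℂ) * ha
  have base : ∀ w : ℝ, 0 < w → w ≤ 1 → ((((Real.Gamma w)⁻¹ : ℝ) : ℂ) =
      (R ^ (1 - w) / (2 * Real.pi) : ℝ) * arcIntegral R (1 - w) +
      (Real.sin (Real.pi * w) / Real.pi * rayIntegral R w : ℝ)) := by
    intro w hw hw1
    rcases hw1.eq_or_lt with rfl | hw1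
    · rw [sub_self, arcIntegral_zero hR]
      simp
      field_simp
    · have hs : 0 < 1 - w := by linarith
      rw [arcIntegral_of_pos hR hs]
      norm_cast
      have hsin : Real.sin (Real.pi * (1 - w)) = Real.sin (Real.pi * w) := by
        rw [mul_sub, mul_one, Real.sin_pi_sub]
      have hspos : 0 < Real.sin (Real.pi * w) :=
        Real.sin_pos_of_pos_of_lt_pi (by positivity) (by nlinarith)
      have hG := Real.Gamma_mul_Gamma_one_sub w
      have hGi := Real.Gamma_eq_integral hs
      have hconv := Real.GammaIntegral_convergent hs
      have hsplit : ∫ t in Set.Ioi (0 : ℝ), Real.exp (-t) * t ^ (1 - w - 1) =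
          (∫ t in (0 : ℝ)..R, Real.exp (-t) * t ^ (1 - w - 1)) + rayIntegral R w := by
        rw [intervalIntegral.integral_of_le hR.le, ← Set.Ioc_union_Ioi_eq_Ioi hR.le,
          setIntegral_union Set.Ioc_disjoint_Ioi_same measurableSet_Ioi
          (hconv.mono_set Set.Ioc_subset_Ioi_self) (hconv.mono_set (Set.Ioi_subset_Ioi hR.le)),
          rayIntegral, show 1 - w - 1 = -w by ring]
      have hRR : R ^ (1 - w) * R ^ (-(1 - w)) = 1 := by
        rw [← Real.rpow_add hR]; simp
      have hGpos := Real.Gamma_pos_of_pos hw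
      have : (Real.Gamma w)⁻¹ = Real.sin (Real.pi * w) / Real.pi * Real.Gamma (1 - w) := by
        field_simp
        rw [eq_div_iff hspos.ne'] at hG
        linarith
      rw [this, hGi, hsplit, hsin]
      field_simp
      linear_combination (-
        ∫ t in (0 : ℝ)..R, Real.exp (-t) * t ^ (1 - w - 1)) * hRR
  have key : ∀ n : ℕ, ∀ w : ℝ, 0 < w → w ≤ n + 1 → ((((Real.Gamma w)⁻¹ : ℝ) : ℂ) =
      (R ^ (1 - w) / (2 * Real.pi) : ℝ) * arcIntegral R (1 - w) +
      (Real.sin (Real.pi * w) / Real.pi * rayIntegral R w : ℝ)) := by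
    intro n
    induction n with
    | zero => simpa using base
    | succ n ih =>
      intro w hw hwn
      push_cast at hwn
      rcases le_or_gt w 1 with h1 | h1
      · exact base w hw h1
      · have := step (w - 1) (by linarith) (ih _ (by linarith) (by linarith))
        rwa [sub_add_cancel] at this
  obtain ⟨n, hn⟩ := exists_nat_ge z
  exact key n z hz (by linarith)

/-- The oscillatory part of Schläfli's integral for `J_ν(2R)`. -/
noncomputable def besselArc (R ν : ℝ) : ℂ :=
  ∫ θ in (-Real.pi)..Real.pi, cexp ((2 * R * Real.sin θ : ℝ) * I) * cexp ((-ν : ℝ) * θ * I)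

/-- The integrand of the decaying part of Schläfli's integral for `J_ν(2R)`. -/
noncomputable def besselRayFun (R ν t : ℝ) : ℝ :=
  Real.exp (-t) * (R ^ ν * t ^ (-(ν + 1))) * Real.exp (R ^ 2 / t)

lemma hasSum_besselArc {R : ℝ} (hR : 0 < R) (ν : ℝ) :
    HasSum (fun m : ℕ => (-R : ℂ) ^ m / m.factorial * arcIntegral R (-(m + ν)))
      (besselArc R ν) := by
  unfold arcIntegral
  simp_rw [← intervalIntegral.integral_const_mul]
  refine intervalIntegral.hasSum_integral_of_dominated_convergence
    (fun n _ => R ^ n / n.factorial * Real.exp R) (fun n => ?_) (fun n => ?_) ?_ ?_ ?_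
  · apply Continuous.aestronglyMeasurable
    fun_prop
  · refine Filter.Eventually.of_forall fun θ _ => ?_
    rw [norm_mul, norm_mul, norm_cexp_mul_I', mul_one, norm_div, norm_pow, norm_neg, norm_natCast,
      Complex.norm_real, Real.norm_eq_abs, abs_of_pos hR]
    gcongr
    rw [Complex.norm_exp]
    gcongr
    calc (R * cexp (θ * I)).re ≤ ‖R * cexp (θ * I)‖ := Complex.re_le_norm _
      _ = R := by simp [Complex.norm_exp_ofReal_mul_I, abs_of_pos hR]
  · exact Filter.Eventually.of_forall fun _ _ =>
      (Real.summable_pow_div_factorial R).mul_right _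
  · exact intervalIntegrable_const
  · refine Filter.Eventually.of_forall fun θ _ => ?_
    have h := (hasSum_cexp (-R * cexp (-(θ * I)))).mul_right
      (cexp (R * cexp (θ * I)) * cexp ((-ν : ℝ) * θ * I))
    have e : (fun m : ℕ => (-R : ℂ) ^ m / m.factorial *
        (cexp (R * cexp (θ * I)) * cexp ((-(m + ν) : ℝ) * θ * I))) =
        fun m : ℕ => (-R * cexp (-(θ * I))) ^ m / m.factorial *
          (cexp (R * cexp (θ * I)) * cexp ((-ν : ℝ) * θ * I)) := by
      funext m
      have : cexp ((-(m + ν) : ℝ) * θ * I) = cexp (-(θ * I)) ^ m * cexp ((-ν : ℝ) * θ * I) := by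
        rw [← Complex.exp_nat_mul, ← Complex.exp_add]
        congr 1
        push_cast
        ring
      rw [this, mul_pow]
      ring
    have e' : cexp ((2 * R * Real.sin θ : ℝ) * I) =
        cexp (-R * cexp (-(θ * I))) * cexp (R * cexp (θ * I)) := by
      rw [← Complex.exp_add]
      congr 1
      push_cast
      rw [Complex.sin]
      ring_nf
      rw [I_sq]
      ring
    rw [e, e', mul_assoc (cexp (-R * cexp (-(θ * I))))]
    exact h

lemma integrableOn_besselRayFun_bound {R : ℝ} (hR : 0 < R) {ν : ℝ} (hν : 0 < ν) :
    IntegrableOn (fun t => R ^ ν * t ^ (-(ν + 1))) (Set.Ioi R) :=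
  (integrableOn_Ioi_rpow_of_lt (by linarith) hR).const_mul _

lemma integral_besselRayFun_bound {R : ℝ} (hR : 0 < R) {ν : ℝ} (hν : 0 < ν) :
    ∫ t in Set.Ioi R, R ^ ν * t ^ (-(ν + 1)) = 1 / ν := by
  rw [integral_const_mul, integral_Ioi_rpow_of_lt (by linarith) hR]
  have : -(ν + 1) + 1 = -ν := by ring
  rw [this, neg_div_neg_eq, mul_div_assoc', ← Real.rpow_add hR]
  simp

lemma measurable_besselRayFun (R ν : ℝ) : Measurable (besselRayFun R ν) := by
  unfold besselRayFun
  fun_prop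

lemma exp_mul_exp_le_one {R t : ℝ} (hR : 0 < R) (ht : R < t) :
    Real.exp (-t) * Real.exp (R ^ 2 / t) ≤ 1 := by
  rw [← Real.exp_add, Real.exp_le_one_iff]
  have : R ^ 2 / t ≤ t := by
    rw [div_le_iff₀ (by linarith)]
    nlinarith
  linarith

lemma besselRayFun_nonneg {R t : ℝ} (hR : 0 < R) (ht : R < t) (ν : ℝ) :
    0 ≤ besselRayFun R ν t := by
  have : 0 < t := hR.trans ht
  unfold besselRayFun
  positivity

lemma besselRayFun_le {R t : ℝ} (hR : 0 < R) (ht : R < t) (ν : ℝ) :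
    besselRayFun R ν t ≤ R ^ ν * t ^ (-(ν + 1)) := by
  have h0 : 0 < t := hR.trans ht
  have h := exp_mul_exp_le_one hR ht
  calc besselRayFun R ν t
      = R ^ ν * t ^ (-(ν + 1)) * (Real.exp (-t) * Real.exp (R ^ 2 / t)) := by
        unfold besselRayFun; ring
    _ ≤ R ^ ν * t ^ (-(ν + 1)) * 1 := by gcongr
    _ = _ := mul_one _

lemma integrableOn_besselRayFun {R : ℝ} (hR : 0 < R) {ν : ℝ} (hν : 0 < ν) :
    IntegrableOn (besselRayFun R ν) (Set.Ioi R) := by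
  refine (integrableOn_besselRayFun_bound hR hν).mono'
    (measurable_besselRayFun R ν).aestronglyMeasurable ?_
  refine (ae_restrict_iff' measurableSet_Ioi).2 (Filter.Eventually.of_forall fun t ht => ?_)
  rw [Real.norm_eq_abs, abs_of_nonneg (besselRayFun_nonneg hR ht ν)]
  exact besselRayFun_le hR ht ν

/-- The decaying part of Schläfli's integral for `J_ν(2R)`. -/
noncomputable def besselRay (R ν : ℝ) : ℝ := ∫ t in Set.Ioi R, besselRayFun R ν t

lemma besselRay_nonneg {R : ℝ} (hR : 0 < R) (ν : ℝ) : 0 ≤ besselRay R ν :=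
  setIntegral_nonneg measurableSet_Ioi fun _ ht => besselRayFun_nonneg hR ht ν

lemma besselRay_le {R : ℝ} (hR : 0 < R) {ν : ℝ} (hν : 0 < ν) : besselRay R ν ≤ 1 / ν := by
  rw [← integral_besselRayFun_bound hR hν]
  exact setIntegral_mono_on (integrableOn_besselRayFun hR hν)
    (integrableOn_besselRayFun_bound hR hν) measurableSet_Ioi
    fun t ht => besselRayFun_le hR ht ν

lemma abs_besselRay_sub_le {R : ℝ} (hR : 0 < R) {α β : ℝ} (hα : 0 < α) (hαβ : α ≤ β) :
    |besselRay R α - besselRay R β| ≤ 1 / α - 1 / β := by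
  have hβ : 0 < β := hα.trans_le hαβ
  have hle : ∀ t, R < t → R ^ β * t ^ (-(β + 1)) ≤ R ^ α * t ^ (-(α + 1)) := by
    intro t ht
    have h0 : 0 < t := hR.trans ht
    have key : ∀ ν : ℝ, R ^ ν * t ^ (-(ν + 1)) = (R / t) ^ ν * t⁻¹ := by
      intro ν
      rw [Real.div_rpow hR.le h0.le, neg_add, Real.rpow_add h0, Real.rpow_neg h0.le,
        Real.rpow_neg_one]
      ring
    rw [key, key]
    refine mul_le_mul_of_nonneg_right ?_ (by positivity)
    exact Real.rpow_le_rpow_of_exponent_ge (by positivity) ((div_le_one h0).2 ht.le) hαβ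
  have hsub : ∀ t, besselRayFun R α t - besselRayFun R β t =
      (R ^ α * t ^ (-(α + 1)) - R ^ β * t ^ (-(β + 1))) *
        (Real.exp (-t) * Real.exp (R ^ 2 / t)) := by
    intro t; unfold besselRayFun; ring
  unfold besselRay
  rw [← integral_sub (integrableOn_besselRayFun hR hα) (integrableOn_besselRayFun hR hβ),
    ← integral_besselRayFun_bound hR hα, ← integral_besselRayFun_bound hR hβ,
    ← integral_sub (integrableOn_besselRayFun_bound hR hα)
      (integrableOn_besselRayFun_bound hR hβ), abs_of_nonneg]
  · refine setIntegral_mono_on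
      ((integrableOn_besselRayFun hR hα).sub (integrableOn_besselRayFun hR hβ))
      ((integrableOn_besselRayFun_bound hR hα).sub (integrableOn_besselRayFun_bound hR hβ))
      measurableSet_Ioi fun t ht => ?_
    rw [hsub]
    exact mul_le_of_le_one_right (sub_nonneg.2 (hle t ht)) (exp_mul_exp_le_one hR ht)
  · refine setIntegral_nonneg measurableSet_Ioi fun t ht => ?_
    rw [hsub]
    exact mul_nonneg (sub_nonneg.2 (hle t ht)) (by positivity)

lemma hasSum_besselRay {R : ℝ} (hR : 0 < R) {ν : ℝ} (hν : 0 < ν) :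
    HasSum (fun m : ℕ => R ^ (2 * (m : ℝ) + ν) / m.factorial * rayIntegral R (m + ν + 1))
      (besselRay R ν) := by
  unfold rayIntegral besselRay
  simp_rw [← integral_const_mul]
  refine hasSum_integral_of_dominated_convergence
    (fun m t => R ^ m / m.factorial * (R ^ ν * t ^ (-(ν + 1)))) (fun m => ?_) (fun m => ?_) ?_ ?_ ?_
  · apply Measurable.aestronglyMeasurable
    fun_prop
  · refine (ae_restrict_iff' measurableSet_Ioi).2 (Filter.Eventually.of_forall fun t ht => ?_)
    have h0 : 0 < t := hR.trans ht
    rw [Real.norm_eq_abs, abs_of_nonneg (by positivity)]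
    have e1 : R ^ (2 * (m : ℝ) + ν) = R ^ m * R ^ m * R ^ ν := by
      rw [Real.rpow_add hR, two_mul, Real.rpow_add hR, Real.rpow_natCast]
    have e2 : t ^ (-((m : ℝ) + ν + 1)) = (t ^ m)⁻¹ * t ^ (-(ν + 1)) := by
      rw [show -((m : ℝ) + ν + 1) = -m + -(ν + 1) by ring, Real.rpow_add h0, Real.rpow_neg h0.le,
        Real.rpow_natCast]
    rw [e1, e2]
    calc R ^ m * R ^ m * R ^ ν / m.factorial * (Real.exp (-t) * ((t ^ m)⁻¹ * t ^ (-(ν + 1))))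
        = R ^ m / m.factorial * (R ^ ν * t ^ (-(ν + 1))) * (Real.exp (-t) * (R / t) ^ m) := by
          rw [div_pow]; ring
      _ ≤ R ^ m / m.factorial * (R ^ ν * t ^ (-(ν + 1))) * (1 * 1) := by
          gcongr
          · exact Real.exp_le_one_iff.2 (by linarith)
          · exact pow_le_one₀ (by positivity) ((div_le_one h0).2 (le_of_lt ht))
      _ = _ := by ring
  · exact Filter.Eventually.of_forall fun t => (Real.summable_pow_div_factorial R).mul_right _
  · simp_rw [tsum_mul_right]
    exact (integrableOn_besselRayFun_bound hR hν).const_mul _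
  · refine (ae_restrict_iff' measurableSet_Ioi).2 (Filter.Eventually.of_forall fun t ht => ?_)
    have h0 : 0 < t := hR.trans ht
    have h := (NormedSpace.expSeries_div_hasSum_exp (R ^ 2 / t)).mul_left
      (Real.exp (-t) * (R ^ ν * t ^ (-(ν + 1))))
    rw [← Real.exp_eq_exp_ℝ] at h
    have e : (fun m : ℕ => R ^ (2 * (m : ℝ) + ν) / m.factorial *
        (Real.exp (-t) * t ^ (-((m : ℝ) + ν + 1)))) = fun m : ℕ =>
        Real.exp (-t) * (R ^ ν * t ^ (-(ν + 1))) * ((R ^ 2 / t) ^ m / m.factorial) := by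
      funext m
      rw [show -((m : ℝ) + ν + 1) = -m + -(ν + 1) by ring, Real.rpow_add h0, Real.rpow_neg h0.le,
        Real.rpow_natCast, Real.rpow_add hR, two_mul, Real.rpow_add hR, Real.rpow_natCast, div_pow]
      ring
    rw [e]
    exact h

/-- Schläfli's integral representation of the Bessel function. -/
lemma hasSum_besselJ {R : ℝ} (hR : 0 < R) {ν : ℝ} (hν : 0 < ν) :
    HasSum (fun m : ℕ => (((-1 : ℝ) ^ m * R ^ (2 * (m : ℝ) + ν) /
      ((m.factorial : ℝ) * Real.Gamma ((m : ℝ) + ν + 1)) : ℝ) : ℂ))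
      ((1 / (2 * Real.pi) : ℝ) * besselArc R ν -
        ((Real.sin (Real.pi * ν) / Real.pi * besselRay R ν : ℝ) : ℂ)) := by
  have h1 := (hasSum_besselArc hR ν).mul_left ((1 / (2 * Real.pi) : ℝ) : ℂ)
  have h2 := Complex.hasSum_ofReal.2
    ((hasSum_besselRay hR hν).mul_left (Real.sin (Real.pi * ν) / Real.pi))
  have e : (fun m : ℕ => (((-1 : ℝ) ^ m * R ^ (2 * (m : ℝ) + ν) /
      ((m.factorial : ℝ) * Real.Gamma ((m : ℝ) + ν + 1)) : ℝ) : ℂ)) = fun m : ℕ =>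
      ((1 / (2 * Real.pi) : ℝ) : ℂ) * ((-R : ℂ) ^ m / m.factorial * arcIntegral R (-(m + ν))) -
      ((Real.sin (Real.pi * ν) / Real.pi *
        (R ^ (2 * (m : ℝ) + ν) / m.factorial * rayIntegral R (m + ν + 1)) : ℝ) : ℂ) := by
    funext m
    have hz : 0 < (m : ℝ) + ν + 1 := by positivity
    have hs : Real.sin (Real.pi * (m + ν + 1)) = -((-1) ^ m * Real.sin (Real.pi * ν)) := by
      rw [show Real.pi * (m + ν + 1) = Real.pi * ν + m * Real.pi + Real.pi by ring,
        Real.sin_add_pi, Real.sin_add_nat_mul_pi]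
    have hpow : R ^ (2 * (m : ℝ) + ν) * R ^ (1 - ((m : ℝ) + ν + 1)) = R ^ m := by
      rw [← Real.rpow_add hR, ← Real.rpow_natCast]
      ring_nf
    have hpow' : ((R ^ (2 * (m : ℝ) + ν) : ℝ) : ℂ) * ((R ^ (1 - ((m : ℝ) + ν + 1)) : ℝ) : ℂ) =
        (R : ℂ) ^ m := by
      rw [← Complex.ofReal_mul, hpow, Complex.ofReal_pow]
    have hsq : ((-1 : ℂ) ^ m) * (-1) ^ m = 1 := by rw [← mul_pow]; simp
    calc _ = ((-1 : ℂ) ^ m * ((R ^ (2 * (m : ℝ) + ν) : ℝ) : ℂ) / (m.factorial : ℂ)) *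
          (((Real.Gamma ((m : ℝ) + ν + 1))⁻¹ : ℝ) : ℂ) := by
            push_cast; rw [← div_div]; ring
      _ = _ := by
        rw [Gamma_inv_eq_hankel hR hz, hs, show 1 - ((m : ℝ) + ν + 1) = -(m + ν) by ring] at *
        rw [neg_pow (R : ℂ), ← hpow']
        push_cast
        linear_combination (-((R ^ (2 * (m : ℝ) + ν) : ℝ) : ℂ) / (m.factorial : ℂ) *
          Complex.sin (Real.pi * ν) / Real.pi * (rayIntegral R (m + ν + 1) : ℂ)) * hsq
  rw [e]
  exact h1.sub h2

lemma besselJ_eq {R : ℝ} (hR : 0 < R) {ν : ℝ} (hν : 0 < ν) :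
    (besselJ ν (2 * R) : ℂ) = (1 / (2 * Real.pi) : ℝ) * besselArc R ν -
        ((Real.sin (Real.pi * ν) / Real.pi * besselRay R ν : ℝ) : ℂ) := by
  rw [← (hasSum_besselJ hR hν).tsum_eq, ← Complex.ofReal_tsum, besselJ,
    mul_div_cancel_left₀ R two_ne_zero]

lemma rpow_mul_exp_neg_le_Gamma {ν : ℝ} (hν : 0 < ν) :
    ν ^ ν * Real.exp (-ν) ≤ Real.Gamma (ν + 1) := by
  have hint := Real.GammaIntegral_convergent (s := ν + 1) (by linarith)
  simp only [add_sub_cancel_right] at hint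
  have hsub : Set.Ioi ν ⊆ Set.Ioi 0 := Set.Ioi_subset_Ioi hν.le
  rw [Real.Gamma_eq_integral (by linarith)]
  simp only [add_sub_cancel_right]
  calc ν ^ ν * Real.exp (-ν) = ∫ t in Set.Ioi ν, Real.exp (-t) * ν ^ ν := by
        rw [integral_mul_const, integral_exp_neg_Ioi, mul_comm]
    _ ≤ ∫ t in Set.Ioi ν, Real.exp (-t) * t ^ ν := by
        refine setIntegral_mono_on ((integrableOn_exp_neg_Ioi ν).mul_const _)
          (hint.mono_set hsub) measurableSet_Ioi fun t ht => ?_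
        have := Real.rpow_le_rpow hν.le (le_of_lt ht) hν.le
        gcongr
    _ ≤ _ := by
        refine setIntegral_mono_set hint ?_ hsub.eventuallyLE
        refine (ae_restrict_iff' measurableSet_Ioi).2 (Filter.Eventually.of_forall fun t ht => ?_)
        have : 0 < t := ht
        simp only [Pi.zero_apply]
        positivity

lemma abs_besselJ_le {R : ℝ} (hR : 0 < R) {ν : ℝ} (hν : 0 < ν) :
    |besselJ ν (2 * R)| ≤ R ^ ν / Real.Gamma (ν + 1) * Real.exp (R ^ 2 / (ν + 1)) := by
  have hΓ : 0 < Real.Gamma (ν + 1) := Real.Gamma_pos_of_pos (by linarith)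
  have h := (NormedSpace.expSeries_div_hasSum_exp (R ^ 2 / (ν + 1))).mul_left
    (R ^ ν / Real.Gamma (ν + 1))
  rw [← Real.exp_eq_exp_ℝ] at h
  unfold besselJ
  rw [← Real.norm_eq_abs]
  refine tsum_of_norm_bounded h fun m => ?_
  have hm : 0 < Real.Gamma ((m : ℝ) + ν + 1) := Real.Gamma_pos_of_pos (by positivity)
  have hG := Gamma_mul_pow_le (s := ν + 1) (by linarith) m
  rw [← add_assoc] at hG
  rw [mul_div_cancel_left₀ R two_ne_zero, norm_div, norm_mul, norm_pow, norm_neg, norm_one, one_pow,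
    one_mul, Real.norm_of_nonneg (by positivity), Real.norm_of_nonneg (by positivity),
    Real.rpow_add hR, show (2 * (m : ℝ)) = ((2 * m : ℕ) : ℝ) by push_cast; rfl, Real.rpow_natCast,
    pow_mul, div_pow]
  calc (R ^ 2) ^ m * R ^ ν / (m.factorial * Real.Gamma (m + ν + 1))
      ≤ (R ^ 2) ^ m * R ^ ν / (m.factorial * (Real.Gamma (ν + 1) * (ν + 1) ^ m)) := by gcongr
    _ = _ := by field_simp

lemma abs_besselJ_le_of_le {R : ℝ} (hR : 0 < R) {k : ℕ} (hk : 8 * R ≤ (k : ℝ) + 1 / 2) {ν : ℝ}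
    (hν : (k : ℝ) + 1 / 2 ≤ ν) : |besselJ ν (2 * R)| ≤ Real.sqrt (8 * R) * (1 / 2) ^ k := by
  have hk0 : (0 : ℝ) ≤ k := k.cast_nonneg
  have hν0 : 0 < ν := by linarith
  have h8 : 8 * R ≤ ν := hk.trans hν
  have hq : 4 * R / ν ≤ 1 / 2 := by
    rw [div_le_div_iff₀ hν0 two_pos]; linarith
  have hexp : Real.exp (65 / 64) ≤ 4 := by
    rw [← Real.le_log_iff_exp_le (by norm_num), show (4 : ℝ) = 2 ^ 2 by norm_num, Real.log_pow]
    have := Real.log_two_gt_d9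
    push_cast
    linarith
  have hR2 : R ^ 2 / (ν + 1) ≤ ν / 64 := by
    rw [div_le_div_iff₀ (by linarith) (by norm_num)]
    nlinarith
  calc |besselJ ν (2 * R)|
      ≤ R ^ ν / Real.Gamma (ν + 1) * Real.exp (R ^ 2 / (ν + 1)) := abs_besselJ_le hR hν0
    _ ≤ R ^ ν / (ν ^ ν * Real.exp (-ν)) * Real.exp (ν / 64) := by
        gcongr
        exact rpow_mul_exp_neg_le_Gamma hν0
    _ = (Real.exp (65 / 64) * R / ν) ^ ν := by
        rw [Real.div_rpow (by positivity) hν0.le, Real.mul_rpow (Real.exp_pos _).le hR.le,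
          ← Real.exp_mul, Real.exp_neg, show 65 / 64 * ν = ν + ν / 64 by ring, Real.exp_add]
        field_simp
    _ ≤ (4 * R / ν) ^ ν := by gcongr
    _ ≤ (4 * R / ν) ^ ((1 / 2 : ℝ) + k) :=
        Real.rpow_le_rpow_of_exponent_ge (by positivity) (by linarith) (by linarith)
    _ = (4 * R / ν) ^ (1 / 2 : ℝ) * (4 * R / ν) ^ k := by
        rw [Real.rpow_add (by positivity), Real.rpow_natCast]
    _ ≤ (8 * R) ^ (1 / 2 : ℝ) * (1 / 2) ^ k := by
        have : 4 * R / ν ≤ 8 * R := by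
          rw [div_le_iff₀ hν0]
          nlinarith
        gcongr
    _ = _ := by rw [Real.sqrt_eq_rpow]

lemma cexp_neg_pi_half (k : ℕ) : cexp (-(I * Real.pi * ((k + 1 / 2 : ℝ) : ℂ)) / 2) =
    cexp (-(I * Real.pi) / 4) * (-I) ^ k := by
  have : (-I : ℂ) = cexp (-(Real.pi / 2 * I)) := by
    rw [Complex.exp_neg, Complex.exp_pi_div_two_mul_I, Complex.inv_I]
  rw [this, ← Complex.exp_nat_mul, ← Complex.exp_add]
  congr 1
  push_cast
  ring

/-- The expansion of a plane wave in Legendre polynomials and Bessel functions. -/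
lemma hasSum_planeWave {x : ℝ} (hx : x ∈ Set.Icc (-1 : ℝ) 1) {R : ℝ} (hR : 0 < R) :
    HasSum (fun k : ℕ => cexp (-(I * Real.pi * ((k + 1 / 2 : ℝ) : ℂ)) / 2) *
      (besselJ (k + 1 / 2) (2 * R) : ℂ) * ((2 * k + 1 : ℝ) : ℂ) * ((legendreP k x : ℝ) : ℂ))
      (cexp (-(I * Real.pi) / 4) * (Real.sqrt R : ℂ) *
        ((((Real.Gamma (3 / 2))⁻¹ : ℝ) : ℂ) * cexp (-I * R * (2 * x)))) := by
  have hfib : ∀ k : ℕ, HasSum (fun m : ℕ => planeWaveTerm x R (k, m))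
      (((2 * k + 1 : ℝ) : ℂ) * ((legendreP k x : ℝ) : ℂ) * (-I) ^ k * (Real.sqrt R : ℂ)⁻¹ *
        (besselJ (k + 1 / 2) (2 * R) : ℂ)) := by
    intro k
    have h := hasSum_besselJ hR (ν := k + 1 / 2) (by positivity)
    rw [← besselJ_eq hR (by positivity)] at h
    have h' := h.mul_left
      (((2 * k + 1 : ℝ) : ℂ) * ((legendreP k x : ℝ) : ℂ) * (-I) ^ k * (Real.sqrt R : ℂ)⁻¹)
    refine (funext fun m => ?_ : (fun m : ℕ => planeWaveTerm x R (k, m)) = _) ▸ h'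
    have hs : (Real.sqrt R : ℂ) ≠ 0 := by exact_mod_cast (Real.sqrt_pos.2 hR).ne'
    have hpow : R ^ (2 * (m : ℝ) + (k + 1 / 2)) = R ^ (k + 2 * m) * Real.sqrt R := by
      rw [Real.sqrt_eq_rpow, ← Real.rpow_natCast, ← Real.rpow_add hR]
      push_cast
      ring_nf
    have hI : (-I : ℂ) ^ (k + 2 * m) = (-I) ^ k * (-1) ^ m := by
      rw [pow_add, pow_mul]; simp
    unfold planeWaveTerm monomialCoeff
    simp only
    rw [hpow, mul_pow, hI, show (m : ℝ) + (k + 1 / 2) + 1 = m + k + 3 / 2 by ring]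
    push_cast
    field_simp
  have h := (hasSum_planeWaveTerm hx hR).prod_fiberwise hfib
  have h' := h.mul_left (cexp (-(I * Real.pi) / 4) * (Real.sqrt R : ℂ))
  refine (funext fun k => ?_ : _ = (fun k : ℕ => _)) ▸ h'
  have hs : (Real.sqrt R : ℂ) ≠ 0 := by exact_mod_cast (Real.sqrt_pos.2 hR).ne'
  rw [cexp_neg_pi_half]
  field_simp

lemma sum_sq_fourier_le {g : ℝ → ℂ} (hg : Continuous g) {M : ℝ}
    (hM : ∀ θ ∈ Set.Icc (-Real.pi) Real.pi, ‖g θ‖ ≤ M) (N : ℕ) :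
    ∑ k ∈ Finset.range N, ‖∫ θ in (-Real.pi)..Real.pi, g θ * cexp ((-k : ℝ) * θ * I)‖ ^ 2 ≤
      (2 * Real.pi * M) ^ 2 := by
  have hpi := Real.pi_pos
  have hab : -Real.pi < Real.pi := by linarith
  have hM0 : 0 ≤ M := (norm_nonneg _).trans (hM 0 ⟨by linarith, hpi.le⟩)
  have hL2 : MemLp g 2 (volume.restrict (Set.Ioc (-Real.pi) Real.pi)) :=
    MemLp.of_bound hg.aestronglyMeasurable M ((ae_restrict_iff' measurableSet_Ioc).2
      (Filter.Eventually.of_forall fun θ hθ => hM θ (Set.Ioc_subset_Icc_self hθ)))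
  have hP := hasSum_sq_fourierCoeffOn hab hL2
  have hcoef : ∀ k : ℕ, fourierCoeffOn hab g k = ((2 * Real.pi)⁻¹ : ℝ) •
      ∫ θ in (-Real.pi)..Real.pi, g θ * cexp ((-k : ℝ) * θ * I) := by
    intro k
    rw [fourierCoeffOn_eq_integral]
    congr 1
    · rw [one_div]; congr 1; ring
    · refine intervalIntegral.integral_congr fun θ _ => ?_
      simp only [smul_eq_mul]
      rw [mul_comm, fourier_coe_apply]
      congr 2
      have : (Real.pi : ℂ) ≠ 0 := by exact_mod_cast hpi.ne'
      push_cast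
      field_simp
      ring
  have hint : (Real.pi - -Real.pi)⁻¹ • ∫ θ in (-Real.pi)..Real.pi, ‖g θ‖ ^ 2 ≤ M ^ 2 := by
    have : ∫ θ in (-Real.pi)..Real.pi, ‖g θ‖ ^ 2 ≤ ∫ θ in (-Real.pi)..Real.pi, M ^ 2 := by
      refine intervalIntegral.integral_mono_on hab.le
        ((hg.norm.pow 2).intervalIntegrable _ _) intervalIntegrable_const fun θ hθ => ?_
      have := hM θ hθ
      gcongr
    rw [intervalIntegral.integral_const, smul_eq_mul] at this
    rw [smul_eq_mul, inv_mul_le_iff₀ (by linarith)]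
    exact this
  have hs := sum_le_hasSum ((Finset.range N).map Nat.castEmbedding)
    (fun _ _ => by positivity) hP
  rw [Finset.sum_map] at hs
  calc _ = (2 * Real.pi) ^ 2 * ∑ k ∈ Finset.range N, ‖fourierCoeffOn hab g (k : ℕ)‖ ^ 2 := by
        rw [Finset.mul_sum]
        refine Finset.sum_congr rfl fun k _ => ?_
        rw [hcoef, norm_smul, Real.norm_of_nonneg (by positivity), ← mul_pow,
          mul_inv_cancel_left₀ (by positivity)]
    _ ≤ (2 * Real.pi) ^ 2 * M ^ 2 := by
        gcongr
        exact hs.trans hint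
    _ = _ := by ring

lemma sum_inv_sq_le (N : ℕ) : ∑ k ∈ Finset.range N, (1 / (2 * (k : ℝ) + 1)) ^ 2 ≤ 3 := by
  have : ∑ k ∈ Finset.range N, (1 / (2 * (k : ℝ) + 1)) ^ 2 ≤ 3 - 2 / ((N : ℝ) + 1) := by
    induction N with
    | zero => norm_num
    | succ N ih =>
      rw [Finset.sum_range_succ]
      have hN : (0 : ℝ) ≤ N := N.cast_nonneg
      have : (1 / (2 * (N : ℝ) + 1)) ^ 2 ≤ 2 / ((N : ℝ) + 1) - 2 / ((N : ℝ) + 1 + 1) := by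
        rw [div_sub_div _ _ (by positivity) (by positivity), div_pow,
          div_le_div_iff₀ (by positivity) (by positivity)]
        nlinarith
      push_cast
      linarith
  have h2 : (0 : ℝ) ≤ 2 / ((N : ℝ) + 1) := by positivity
  linarith

lemma sum_le_sqrt_mul_of_le {N : ℕ} {x u v w : ℕ → ℝ} {p q r U V W : ℝ}
    (hx0 : ∀ k, 0 ≤ x k) (hx : ∀ k, x k ≤ p * u k + q * v k + r * w k)
    (hu : ∑ k ∈ Finset.range N, u k ^ 2 ≤ U) (hv : ∑ k ∈ Finset.range N, v k ^ 2 ≤ V)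
    (hw : ∑ k ∈ Finset.range N, w k ^ 2 ≤ W) :
    ∑ k ∈ Finset.range N, x k ≤
      Real.sqrt N * Real.sqrt (3 * (p ^ 2 * U + q ^ 2 * V + r ^ 2 * W)) := by
  have h1 : (∑ k ∈ Finset.range N, x k) ^ 2 ≤ N * ∑ k ∈ Finset.range N, x k ^ 2 := by
    simpa using sq_sum_le_card_mul_sum_sq (s := Finset.range N) (f := x)
  have h2 : ∑ k ∈ Finset.range N, x k ^ 2 ≤ 3 * (p ^ 2 * U + q ^ 2 * V + r ^ 2 * W) := by
    calc _ ≤ ∑ k ∈ Finset.range N, 3 * (p ^ 2 * u k ^ 2 + q ^ 2 * v k ^ 2 + r ^ 2 * w k ^ 2) := by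
          refine Finset.sum_le_sum fun k _ => ?_
          have := pow_le_pow_left₀ (hx0 k) (hx k) 2
          nlinarith [sq_nonneg (p * u k - q * v k), sq_nonneg (p * u k - r * w k),
            sq_nonneg (q * v k - r * w k)]
      _ = 3 * (p ^ 2 * ∑ k ∈ Finset.range N, u k ^ 2 + q ^ 2 * ∑ k ∈ Finset.range N, v k ^ 2 +
            r ^ 2 * ∑ k ∈ Finset.range N, w k ^ 2) := by
          rw [← Finset.mul_sum, Finset.sum_add_distrib, Finset.sum_add_distrib, Finset.mul_sum,
            Finset.mul_sum, Finset.mul_sum]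
      _ ≤ _ := by gcongr
  rw [← Real.sqrt_mul N.cast_nonneg]
  refine Real.le_sqrt_of_sq_le (h1.trans ?_)
  gcongr

lemma norm_cexp_sub_one_sub_le (x : ℝ) : ‖cexp (I * x) - 1 - I * x‖ ≤ 2 * x ^ 2 := by
  have hn : ‖I * (x : ℂ)‖ = |x| := by simp
  rcases le_total |x| 1 with h | h
  · have := Complex.norm_exp_sub_one_sub_id_le (x := I * x) (by rwa [hn])
    rw [hn, sq_abs] at this
    nlinarith [sq_nonneg x]
  · have h1 : ‖cexp (I * x) - 1‖ ≤ |x| := Real.norm_exp_I_mul_ofReal_sub_one_le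
    have h2 := norm_sub_le (cexp (I * x) - 1) (I * x)
    rw [hn] at h2
    nlinarith [sq_abs x]

/-- The half-integer phase whose Fourier coefficients are the oscillatory parts of the
half-integer Bessel functions. -/
noncomputable def besselPhase (R θ : ℝ) : ℂ :=
  cexp ((2 * R * Real.sin θ : ℝ) * I) * cexp ((-(1 / 2) : ℝ) * θ * I)

lemma continuous_besselPhase (R : ℝ) : Continuous (besselPhase R) := by
  unfold besselPhase
  fun_prop

lemma norm_besselPhase (R θ : ℝ) : ‖besselPhase R θ‖ = 1 := by
  rw [besselPhase, norm_mul, norm_cexp_mul_I', Complex.norm_exp_ofReal_mul_I, one_mul]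

/-- The Fourier coefficients of `besselPhase`. -/
noncomputable def phaseCoeff (R : ℝ) (k : ℕ) : ℂ :=
  ∫ θ in (-Real.pi)..Real.pi, besselPhase R θ * cexp ((-k : ℝ) * θ * I)

/-- The Fourier coefficients of `θ * besselPhase`. -/
noncomputable def momentCoeff (R : ℝ) (k : ℕ) : ℂ :=
  ∫ θ in (-Real.pi)..Real.pi, ((θ : ℂ) * besselPhase R θ) * cexp ((-k : ℝ) * θ * I)

lemma besselArc_half (R : ℝ) (k : ℕ) : besselArc R (k + 1 / 2) = phaseCoeff R k := by
  unfold besselArc phaseCoeff besselPhase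
  refine intervalIntegral.integral_congr fun θ _ => ?_
  simp only [← Complex.exp_add]
  congr 1
  push_cast
  ring

lemma sum_sq_phaseCoeff_le (R : ℝ) (N : ℕ) :
    ∑ k ∈ Finset.range N, ‖phaseCoeff R k‖ ^ 2 ≤ (2 * Real.pi * 1) ^ 2 :=
  sum_sq_fourier_le (continuous_besselPhase R) (fun θ _ => (norm_besselPhase R θ).le) N

lemma sum_sq_momentCoeff_le (R : ℝ) (N : ℕ) :
    ∑ k ∈ Finset.range N, ‖momentCoeff R k‖ ^ 2 ≤ (2 * Real.pi * Real.pi) ^ 2 := by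
  refine sum_sq_fourier_le (g := fun θ : ℝ => (θ : ℂ) * besselPhase R θ)
    (Complex.continuous_ofReal.mul (continuous_besselPhase R)) (fun θ hθ => ?_) N
  rw [norm_mul, norm_besselPhase, mul_one, Complex.norm_real]
  exact abs_le.2 hθ

lemma norm_besselArc_sub_le (R : ℝ) (k : ℕ) {δ : ℝ} (hδ : 0 ≤ δ) :
    ‖besselArc R (k + 1 / 2 + δ) - besselArc R (k + 1 / 2)‖ ≤
      δ * ‖momentCoeff R k‖ + 4 * Real.pi ^ 3 * δ ^ 2 := by
  have hpi := Real.pi_pos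
  set E : ℝ → ℂ := fun θ => besselPhase R θ * cexp ((-k : ℝ) * θ * I) with hE
  have hEc : Continuous E := (continuous_besselPhase R).mul (by fun_prop)
  have hEn : ∀ θ, ‖E θ‖ = 1 := fun θ => by
    rw [hE]; simp only; rw [norm_mul, norm_besselPhase, norm_cexp_mul_I', one_mul]
  set P : ℝ → ℂ := fun θ => cexp (I * ((-δ * θ : ℝ) : ℂ)) with hP
  have hPc : Continuous P := by rw [hP]; fun_prop
  have h1 : besselArc R (k + 1 / 2 + δ) = ∫ θ in (-Real.pi)..Real.pi, E θ * P θ := by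
    unfold besselArc
    refine intervalIntegral.integral_congr fun θ _ => ?_
    simp only [hE, hP, besselPhase, ← Complex.exp_add]
    congr 1
    push_cast
    ring
  have h2 : besselArc R (k + 1 / 2) = ∫ θ in (-Real.pi)..Real.pi, E θ := besselArc_half R k
  have h3 : momentCoeff R k = ∫ θ in (-Real.pi)..Real.pi, (θ : ℂ) * E θ := by
    unfold momentCoeff
    refine intervalIntegral.integral_congr fun θ _ => ?_
    simp only [hE]
    ring
  have hsplit : besselArc R (k + 1 / 2 + δ) - besselArc R (k + 1 / 2) =
      (-(I * δ)) * momentCoeff R k +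
        ∫ θ in (-Real.pi)..Real.pi, E θ * (P θ - 1 - I * ((-δ * θ : ℝ) : ℂ)) := by
    rw [h1, h2, h3, ← intervalIntegral.integral_sub, ← intervalIntegral.integral_const_mul,
      ← intervalIntegral.integral_add]
    · refine intervalIntegral.integral_congr fun θ _ => ?_
      push_cast
      ring
    all_goals
      apply Continuous.intervalIntegrable
      fun_prop
  rw [hsplit]
  refine (norm_add_le _ _).trans (add_le_add ?_ ?_)
  · rw [norm_mul, norm_neg, norm_mul, Complex.norm_I, one_mul, Complex.norm_real,
      Real.norm_of_nonneg hδ]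
  · have hb : ∀ θ ∈ Set.uIoc (-Real.pi) Real.pi,
        ‖E θ * (P θ - 1 - I * ((-δ * θ : ℝ) : ℂ))‖ ≤ 2 * (δ * Real.pi) ^ 2 := by
      intro θ hθ
      rw [Set.uIoc_of_le (by linarith)] at hθ
      have hθ' : θ ^ 2 ≤ Real.pi ^ 2 := sq_le_sq' hθ.1.le hθ.2
      rw [norm_mul, hEn, one_mul]
      refine (norm_cexp_sub_one_sub_le _).trans ?_
      rw [mul_pow, mul_pow, neg_sq]
      gcongr
    refine (intervalIntegral.norm_integral_le_of_norm_le_const hb).trans (le_of_eq ?_)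
    rw [abs_of_pos (by linarith)]
    ring

lemma norm_cexp_neg_pi (ν : ℝ) : ‖cexp (-(I * Real.pi * (ν : ℂ)) / 2)‖ = 1 := by
  rw [show -(I * Real.pi * (ν : ℂ)) / 2 = ((-(Real.pi * ν / 2) : ℝ) : ℂ) * I by push_cast; ring,
    Complex.norm_exp_ofReal_mul_I]

lemma norm_cexp_neg_pi_sub_le (α δ : ℝ) :
    ‖cexp (-(I * Real.pi * ((α + δ : ℝ) : ℂ)) / 2) - cexp (-(I * Real.pi * (α : ℂ)) / 2)‖ ≤
      Real.pi / 2 * |δ| := by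
  have : cexp (-(I * Real.pi * ((α + δ : ℝ) : ℂ)) / 2) - cexp (-(I * Real.pi * (α : ℂ)) / 2) =
      cexp (-(I * Real.pi * (α : ℂ)) / 2) * (cexp (I * ((-(Real.pi / 2 * δ) : ℝ) : ℂ)) - 1) := by
    rw [mul_sub, ← Complex.exp_add, mul_one]
    congr 2
    push_cast
    ring
  rw [this, norm_mul, norm_cexp_neg_pi, one_mul]
  refine Real.norm_exp_I_mul_ofReal_sub_one_le.trans (le_of_eq ?_)
  rw [norm_neg, norm_mul, Real.norm_of_nonneg (by positivity), Real.norm_eq_abs]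

lemma abs_sin_mul_besselRay_sub_le {R : ℝ} (hR : 0 < R) {α δ : ℝ} (hα : 0 < α) (hδ : 0 ≤ δ) :
    |Real.sin (Real.pi * (α + δ)) / Real.pi * besselRay R (α + δ) -
      Real.sin (Real.pi * α) / Real.pi * besselRay R α| ≤ δ / α + δ / α ^ 2 := by
  have hpi := Real.pi_pos
  have hβ : 0 < α + δ := by linarith
  have h1 : |Real.sin (Real.pi * (α + δ)) - Real.sin (Real.pi * α)| / Real.pi ≤ δ := by
    rw [div_le_iff₀ hpi]
    refine (Real.abs_sin_sub_sin_le _ _).trans (le_of_eq ?_)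
    rw [show Real.pi * (α + δ) - Real.pi * α = δ * Real.pi by ring, abs_of_nonneg (by positivity)]
  have h2 : |Real.sin (Real.pi * α)| / Real.pi ≤ 1 := by
    rw [div_le_one hpi]
    exact (Real.abs_sin_le_one _).trans (by linarith [Real.pi_gt_three])
  have h3 : besselRay R (α + δ) ≤ 1 / α :=
    (besselRay_le hR hβ).trans (one_div_le_one_div_of_le hα (by linarith))
  have h4 : |besselRay R (α + δ) - besselRay R α| ≤ δ / α ^ 2 := by
    rw [abs_sub_comm]
    refine (abs_besselRay_sub_le hR hα (le_add_of_nonneg_right hδ)).trans ?_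
    rw [div_sub_div _ _ hα.ne' hβ.ne', show 1 * (α + δ) - α * 1 = δ by ring, sq]
    gcongr
    linarith
  calc _ = |(Real.sin (Real.pi * (α + δ)) - Real.sin (Real.pi * α)) / Real.pi *
        besselRay R (α + δ) + Real.sin (Real.pi * α) / Real.pi *
          (besselRay R (α + δ) - besselRay R α)| := by congr 1; ring
    _ ≤ |Real.sin (Real.pi * (α + δ)) - Real.sin (Real.pi * α)| / Real.pi *
        besselRay R (α + δ) + |Real.sin (Real.pi * α)| / Real.pi *
          |besselRay R (α + δ) - besselRay R α| := by
        refine (abs_add_le _ _).trans (le_of_eq ?_)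
        rw [abs_mul, abs_mul, abs_div, abs_div, abs_of_pos hpi,
          abs_of_nonneg (besselRay_nonneg hR (α + δ))]
    _ ≤ δ * (1 / α) + 1 * (δ / α ^ 2) := by
        have := besselRay_nonneg hR (α + δ)
        gcongr
    _ = _ := by ring

lemma abs_sin_mul_besselRay_le {R : ℝ} (hR : 0 < R) {α : ℝ} (hα : 0 < α) :
    |Real.sin (Real.pi * α) / Real.pi * besselRay R α| ≤ 1 / α := by
  have hpi := Real.pi_pos
  have h2 : |Real.sin (Real.pi * α)| / Real.pi ≤ 1 := by
    rw [div_le_one hpi]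
    exact (Real.abs_sin_le_one _).trans (by linarith [Real.pi_gt_three])
  have h0 := besselRay_nonneg hR α
  rw [abs_mul, abs_div, abs_of_pos hpi, abs_of_nonneg h0]
  calc _ ≤ 1 * (1 / α) := mul_le_mul h2 (besselRay_le hR hα) h0 zero_le_one
    _ = _ := one_mul _

lemma norm_besselJ_half_le {R : ℝ} (hR : 0 < R) (k : ℕ) :
    ‖(besselJ (k + 1 / 2) (2 * R) : ℂ)‖ ≤
      1 / (2 * Real.pi) * ‖phaseCoeff R k‖ + 2 * (1 / (2 * k + 1)) := by
  have hα : (0 : ℝ) < k + 1 / 2 := by positivity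
  rw [besselJ_eq hR hα, besselArc_half]
  refine (norm_sub_le _ _).trans (add_le_add (le_of_eq ?_) ?_)
  · rw [norm_mul, Complex.norm_real, Real.norm_of_nonneg (by positivity)]
  · rw [Complex.norm_real]
    refine (abs_sin_mul_besselRay_le hR hα).trans (le_of_eq ?_)
    field_simp

lemma norm_besselJ_sub_le {R : ℝ} (hR : 0 < R) (k : ℕ) {δ : ℝ} (hδ : 0 ≤ δ) :
    ‖(besselJ (k + 1 / 2 + δ) (2 * R) : ℂ) - (besselJ (k + 1 / 2) (2 * R) : ℂ)‖ ≤
      δ / (2 * Real.pi) * ‖momentCoeff R k‖ + 2 * Real.pi ^ 2 * δ ^ 2 + 6 * δ / (2 * k + 1) := by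
  have hα : (0 : ℝ) < k + 1 / 2 := by positivity
  have hpi := Real.pi_pos
  rw [besselJ_eq hR hα, besselJ_eq hR (by linarith : (0 : ℝ) < k + 1 / 2 + δ)]
  have hray := abs_sin_mul_besselRay_sub_le hR hα hδ
  have harc := norm_besselArc_sub_le R k hδ
  have hαδ : δ / ((k : ℝ) + 1 / 2) + δ / ((k : ℝ) + 1 / 2) ^ 2 ≤ 6 * δ / (2 * k + 1) := by
    have hk : (0 : ℝ) ≤ k := k.cast_nonneg
    rw [div_add_div _ _ hα.ne' (by positivity), div_le_div_iff₀ (by positivity) (by positivity)]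
    have : 0 ≤ δ * k := by positivity
    nlinarith [mul_nonneg this hk, mul_nonneg (mul_nonneg this hk) hk]
  rw [show ∀ x y z w : ℂ, x - y - (z - w) = (x - z) - (y - w) by intros; ring, ← mul_sub,
    ← Complex.ofReal_sub]
  refine (norm_sub_le _ _).trans ?_
  rw [norm_mul, Complex.norm_real, Complex.norm_real, Real.norm_of_nonneg (by positivity),
    Real.norm_eq_abs]
  refine add_le_add ?_ (hray.trans hαδ)
  calc _ ≤ 1 / (2 * Real.pi) * (δ * ‖momentCoeff R k‖ + 4 * Real.pi ^ 3 * δ ^ 2) := by gcongr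
    _ = _ := by field_simp; ring

/-- The difference between the `k`-th phase-weighted Bessel functions for the coupling constants
`a` and `0`. -/
noncomputable def besselDiff (a R : ℝ) (k : ℕ) : ℂ :=
  cexp (-(I * Real.pi * (betaCoef a k : ℂ)) / 2) * (besselJ (betaCoef a k) (2 * R) : ℂ) -
    cexp (-(I * Real.pi * ((k + 1 / 2 : ℝ) : ℂ)) / 2) * (besselJ (k + 1 / 2) (2 * R) : ℂ)

lemma le_betaCoef {a : ℝ} (ha : 0 ≤ a) (k : ℕ) : (k : ℝ) + 1 / 2 ≤ betaCoef a k :=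
  Real.le_sqrt_of_sq_le (by linarith)

lemma mul_betaCoef_sub_le {a : ℝ} (ha : 0 ≤ a) (k : ℕ) :
    (2 * (k : ℝ) + 1) * (betaCoef a k - (k + 1 / 2)) ≤ a := by
  have h := le_betaCoef ha k
  have h2 : betaCoef a k ^ 2 = ((k : ℝ) + 1 / 2) ^ 2 + a := Real.sq_sqrt (by positivity)
  nlinarith

lemma mul_norm_besselDiff_le {a : ℝ} (ha : 0 ≤ a) {R : ℝ} (hR : 0 < R) (k : ℕ) :
    (2 * (k : ℝ) + 1) * ‖besselDiff a R k‖ ≤ a / (2 * Real.pi) * ‖momentCoeff R k‖ +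
      a / 4 * ‖phaseCoeff R k‖ +
      (2 * Real.pi ^ 2 * a ^ 2 + 6 * a + Real.pi * a) * (1 / (2 * k + 1)) := by
  have hpi := Real.pi_pos
  obtain ⟨δ, hδ⟩ : ∃ δ, betaCoef a k = k + 1 / 2 + δ := ⟨betaCoef a k - (k + 1 / 2), by ring⟩
  have hδ0 : 0 ≤ δ := by linarith [le_betaCoef ha k]
  have hδa : (2 * (k : ℝ) + 1) * δ ≤ a := by
    have := mul_betaCoef_sub_le ha k
    rwa [hδ, add_sub_cancel_left] at this
  set n : ℝ := 2 * k + 1 with hn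
  have hn0 : 0 < n := by positivity
  have hn1 : δ ≤ a * (1 / n) := by
    rw [mul_one_div, le_div_iff₀ hn0]; linarith
  have h1 := norm_besselJ_sub_le hR k hδ0
  have h2 := norm_besselJ_half_le hR k
  have h3 := norm_cexp_neg_pi_sub_le (k + 1 / 2) δ
  rw [← hn] at h1 h2
  rw [abs_of_nonneg hδ0] at h3
  have hD : ‖besselDiff a R k‖ ≤
      (δ / (2 * Real.pi) * ‖momentCoeff R k‖ + 2 * Real.pi ^ 2 * δ ^ 2 + 6 * δ / n) +
        Real.pi / 2 * δ * (1 / (2 * Real.pi) * ‖phaseCoeff R k‖ + 2 * (1 / n)) := by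
    unfold besselDiff
    rw [hδ, show ∀ x y z w : ℂ, x * y - z * w = x * (y - w) + (x - z) * w by intros; ring]
    refine (norm_add_le _ _).trans ?_
    rw [norm_mul, norm_mul, norm_cexp_neg_pi, one_mul]
    gcongr
  calc n * ‖besselDiff a R k‖
      ≤ n * ((δ / (2 * Real.pi) * ‖momentCoeff R k‖ + 2 * Real.pi ^ 2 * δ ^ 2 + 6 * δ / n) +
        Real.pi / 2 * δ * (1 / (2 * Real.pi) * ‖phaseCoeff R k‖ + 2 * (1 / n))) := by gcongr
    _ = n * δ / (2 * Real.pi) * ‖momentCoeff R k‖ + n * δ / 4 * ‖phaseCoeff R k‖ +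
        (2 * Real.pi ^ 2 * (n * δ) * δ + (6 + Real.pi) * δ) := by field_simp; ring
    _ ≤ a / (2 * Real.pi) * ‖momentCoeff R k‖ + a / 4 * ‖phaseCoeff R k‖ +
        (2 * Real.pi ^ 2 * a * (a * (1 / n)) + (6 + Real.pi) * (a * (1 / n))) := by gcongr
    _ = _ := by ring

lemma exists_sum_besselDiff_le_sqrt_card {a : ℝ} (ha : 0 ≤ a) : ∃ C ≥ 0, ∀ R : ℝ, 0 < R → ∀ N : ℕ,
    ∑ k ∈ Finset.range N, (2 * (k : ℝ) + 1) * ‖besselDiff a R k‖ ≤ Real.sqrt N * C :=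
  ⟨_, Real.sqrt_nonneg _, fun R hR N =>
    sum_le_sqrt_mul_of_le (fun k => by positivity) (mul_norm_besselDiff_le ha hR)
      (sum_sq_momentCoeff_le R N) (sum_sq_phaseCoeff_le R N) (sum_inv_sq_le N)⟩

lemma norm_besselDiff_le_of_le {a : ℝ} (ha : 0 ≤ a) {R : ℝ} (hR : 0 < R) {k : ℕ}
    (hk : 8 * R ≤ (k : ℝ) + 1 / 2) :
    ‖besselDiff a R k‖ ≤ 2 * (Real.sqrt (8 * R) * (1 / 2) ^ k) := by
  unfold besselDiff
  refine (norm_sub_le _ _).trans ?_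
  rw [norm_mul, norm_mul, norm_cexp_neg_pi, norm_cexp_neg_pi, one_mul, one_mul, Complex.norm_real,
    Complex.norm_real, two_mul (Real.sqrt (8 * R) * _)]
  exact add_le_add (abs_besselJ_le_of_le hR hk (le_betaCoef ha k))
    (abs_besselJ_le_of_le hR hk le_rfl)

lemma summable_two_mul_add_one_mul_geometric :
    Summable fun k : ℕ => (2 * (k : ℝ) + 1) * (1 / 2) ^ k := by
  have h1 := (summable_pow_mul_geometric_of_norm_lt_one 1
    (by norm_num : ‖(1 / 2 : ℝ)‖ < 1)).mul_left 2
  have h2 := summable_geometric_of_lt_one (r := (1 / 2 : ℝ)) (by norm_num) (by norm_num)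
  refine (h1.add h2).congr fun k => ?_
  ring

lemma exists_sum_besselDiff_le {a : ℝ} (ha : 0 ≤ a) : ∃ C ≥ 0, ∀ R : ℝ, 0 < R → ∀ M : ℕ,
    ∑ k ∈ Finset.range M, (2 * (k : ℝ) + 1) * ‖besselDiff a R k‖ ≤ C * Real.sqrt R := by
  obtain ⟨C, hC0, hC⟩ := exists_sum_besselDiff_le_sqrt_card ha
  set S : ℝ := ∑' k : ℕ, (2 * (k : ℝ) + 1) * (1 / 2) ^ k with hS
  have hS0 : 0 ≤ S := tsum_nonneg fun k => by positivity
  refine ⟨4 * C + 2 * Real.sqrt 8 * S, by positivity, fun R hR M => ?_⟩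
  set N : ℕ := ⌊8 * R + 1 / 2⌋₊ with hN
  have hNle : Real.sqrt N ≤ 4 * Real.sqrt R := by
    have h16 : (N : ℝ) ≤ 16 * R := by
      have hle : (N : ℝ) ≤ 8 * R + 1 / 2 := Nat.floor_le (by positivity)
      rcases Nat.eq_zero_or_pos N with h | h
      · rw [h]; simp only [Nat.cast_zero]; positivity
      · have : (1 : ℝ) ≤ N := by exact_mod_cast h
        linarith
    calc Real.sqrt N ≤ Real.sqrt (16 * R) := Real.sqrt_le_sqrt h16
      _ = 4 * Real.sqrt R := by
        rw [Real.sqrt_mul (by norm_num), show (16 : ℝ) = 4 ^ 2 by norm_num,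
          Real.sqrt_sq (by norm_num)]
  have hterm : ∀ k : ℕ, (2 * (k : ℝ) + 1) * ‖besselDiff a R k‖ ≤
      (if k ∈ Finset.range N then (2 * (k : ℝ) + 1) * ‖besselDiff a R k‖ else 0) +
        2 * Real.sqrt (8 * R) * ((2 * (k : ℝ) + 1) * (1 / 2) ^ k) := by
    intro k
    split_ifs with h
    · have : 0 ≤ 2 * Real.sqrt (8 * R) * ((2 * (k : ℝ) + 1) * (1 / 2) ^ k) := by positivity
      linarith
    · have hk : (N : ℝ) ≤ k := by exact_mod_cast not_lt.1 (fun h' => h (Finset.mem_range.2 h'))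
      have hlt : 8 * R + 1 / 2 < N + 1 := Nat.lt_floor_add_one _
      have := norm_besselDiff_le_of_le ha hR (k := k) (by linarith)
      calc _ ≤ (2 * (k : ℝ) + 1) * (2 * (Real.sqrt (8 * R) * (1 / 2) ^ k)) := by gcongr
        _ = _ := by ring
  calc _ ≤ ∑ k ∈ Finset.range M,
        ((if k ∈ Finset.range N then (2 * (k : ℝ) + 1) * ‖besselDiff a R k‖ else 0) +
          2 * Real.sqrt (8 * R) * ((2 * (k : ℝ) + 1) * (1 / 2) ^ k)) :=
        Finset.sum_le_sum fun k _ => hterm k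
    _ = ∑ k ∈ Finset.range M ∩ Finset.range N, (2 * (k : ℝ) + 1) * ‖besselDiff a R k‖ +
          2 * Real.sqrt (8 * R) * ∑ k ∈ Finset.range M, (2 * (k : ℝ) + 1) * (1 / 2) ^ k := by
        rw [Finset.sum_add_distrib, Finset.sum_ite_mem, Finset.mul_sum]
    _ ≤ Real.sqrt N * C + 2 * Real.sqrt (8 * R) * S := by
        gcongr
        · exact (Finset.sum_le_sum_of_subset_of_nonneg Finset.inter_subset_right
            fun k _ _ => by positivity).trans (hC R hR N)
        · exact summable_two_mul_add_one_mul_geometric.sum_le_tsum _ fun k _ => by positivity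
    _ ≤ 4 * Real.sqrt R * C + 2 * Real.sqrt (8 * R) * S := by gcongr
    _ = _ := by rw [Real.sqrt_mul (by norm_num)]; ring

/-- The uniform bound on the partial-wave sum of the Schrödinger kernel. -/
lemma exists_norm_tsum_besselJ_le {a : ℝ} (ha : 0 ≤ a) : ∃ C > 0, ∀ R : ℝ, 0 < R →
    ∀ x ∈ Set.Icc (-1 : ℝ) 1,
      ‖∑' k : ℕ, cexp (-(I * Real.pi * (betaCoef a k : ℂ)) / 2) *
        (besselJ (betaCoef a k) (2 * R) : ℂ) * (((2 * (k : ℝ) + 1) / (4 * Real.pi) : ℝ) : ℂ) *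
        ((legendreP k x : ℝ) : ℂ)‖ ≤ C * Real.sqrt R := by
  obtain ⟨C, hC0, hC⟩ := exists_sum_besselDiff_le ha
  have hΓ : 0 < (Real.Gamma (3 / 2))⁻¹ := inv_pos.2 (Real.Gamma_pos_of_pos (by norm_num))
  have hpi := Real.pi_pos
  refine ⟨1 / (4 * Real.pi) * ((Real.Gamma (3 / 2))⁻¹ + C), by positivity, fun R hR x hx => ?_⟩
  set D : ℕ → ℂ := fun k =>
    besselDiff a R k * ((2 * k + 1 : ℝ) : ℂ) * ((legendreP k x : ℝ) : ℂ) with hD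
  have hDle : ∀ k, ‖D k‖ ≤ (2 * (k : ℝ) + 1) * ‖besselDiff a R k‖ := by
    intro k
    rw [hD]
    simp only
    rw [norm_mul, norm_mul, Complex.norm_real, Complex.norm_real,
      Real.norm_of_nonneg (by positivity), mul_comm ‖besselDiff a R k‖]
    exact mul_le_of_le_one_right (by positivity) (abs_legendreP_le_one k hx)
  have hsum : Summable fun k : ℕ => (2 * (k : ℝ) + 1) * ‖besselDiff a R k‖ :=
    summable_of_sum_range_le (fun k => by positivity) (hC R hR)
  have hDsum : Summable D := Summable.of_norm_bounded hsum hDle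
  have hDnorm : ‖∑' k, D k‖ ≤ C * Real.sqrt R :=
    (tsum_of_norm_bounded hsum.hasSum hDle).trans
      (Real.tsum_le_of_sum_range_le (fun k => by positivity) (hC R hR))
  have hpw := hasSum_planeWave hx hR
  have htotal := (hpw.add hDsum.hasSum).mul_left (((1 / (4 * Real.pi) : ℝ)) : ℂ)
  have heq : (fun k : ℕ => cexp (-(I * Real.pi * (betaCoef a k : ℂ)) / 2) *
        (besselJ (betaCoef a k) (2 * R) : ℂ) * (((2 * (k : ℝ) + 1) / (4 * Real.pi) : ℝ) : ℂ) *
        ((legendreP k x : ℝ) : ℂ)) = fun k : ℕ => ((1 / (4 * Real.pi) : ℝ) : ℂ) *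
      (cexp (-(I * Real.pi * ((k + 1 / 2 : ℝ) : ℂ)) / 2) *
      (besselJ (k + 1 / 2) (2 * R) : ℂ) * ((2 * k + 1 : ℝ) : ℂ) * ((legendreP k x : ℝ) : ℂ) +
        D k) := by
    funext k
    simp only [hD, besselDiff]
    push_cast
    ring
  rw [heq, htotal.tsum_eq, norm_mul, Complex.norm_real, Real.norm_of_nonneg (by positivity),
    mul_assoc _ (_ + C)]
  refine mul_le_mul_of_nonneg_left ?_ (by positivity)
  rw [add_mul]
  refine (norm_add_le _ _).trans (add_le_add (le_of_eq ?_) hDnorm)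
  have e1 : ‖cexp (-(I * Real.pi) / 4)‖ = 1 := by
    rw [show -(I * Real.pi) / 4 = ((-(Real.pi / 4) : ℝ) : ℂ) * I by push_cast; ring,
      Complex.norm_exp_ofReal_mul_I]
  have e2 : ‖cexp (-I * R * (2 * x))‖ = 1 := by
    rw [show -I * R * (2 * x) = ((-(R * (2 * x)) : ℝ) : ℂ) * I by push_cast; ring,
      Complex.norm_exp_ofReal_mul_I]
  rw [norm_mul, norm_mul, norm_mul, e1, e2, Complex.norm_real, Complex.norm_real,
    Real.norm_of_nonneg (Real.sqrt_nonneg R), Real.norm_of_nonneg hΓ.le]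
  ring

end PartialWaves

theorem stmt2 (a : ℝ) (ha : 0 ≤ a) :
    ∃ C > 0, ∀ t : ℝ, t ∈ Set.Ioo 0 Real.pi → ∀ r₁ r₂ : ℝ, 0 < r₁ → 0 < r₂ →
      ∀ τ : ℝ, τ ∈ Set.Icc (-1 : ℝ) 1 →
        (2 * Real.sqrt (r₁ * r₂) * Real.sin t)⁻¹ *
          ‖∑' k : ℕ, Complex.exp (-(Complex.I * Real.pi * (betaCoef a k : ℂ)) / 2) *
              (besselJ (betaCoef a k) (r₁ * r₂ / (2 * Real.sin t)) : ℂ) *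
              (((2 * (k : ℝ) + 1) / (4 * Real.pi) : ℝ) : ℂ) *
              ((legendreP k τ : ℝ) : ℂ)‖ ≤ C * Real.sin t ^ (-(3 : ℝ) / 2) := by
  obtain ⟨C, hC0, hC⟩ := exists_norm_tsum_besselJ_le ha
  refine ⟨C, hC0, fun t ht r₁ r₂ h₁ h₂ τ hτ => ?_⟩
  have hs : 0 < Real.sin t := Real.sin_pos_of_mem_Ioo ht
  have hr : 0 < Real.sqrt (r₁ * r₂) := Real.sqrt_pos.2 (by positivity)
  have h := hC (r₁ * r₂ / (4 * Real.sin t)) (by positivity) τ hτ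
  rw [show 2 * (r₁ * r₂ / (4 * Real.sin t)) = r₁ * r₂ / (2 * Real.sin t) by field_simp; ring,
    Real.sqrt_div (by positivity), Real.sqrt_mul (by norm_num : (0 : ℝ) ≤ 4)] at h
  have h4 : Real.sqrt 4 = 2 := by
    rw [show (4 : ℝ) = 2 ^ 2 by norm_num, Real.sqrt_sq (by norm_num)]
  rw [h4] at h
  have hpow : Real.sin t ^ (-(3 : ℝ) / 2) = (Real.sin t)⁻¹ * (Real.sqrt (Real.sin t))⁻¹ := by
    rw [show (-(3 : ℝ) / 2) = -1 + -(1 / 2) by norm_num, Real.rpow_add hs, Real.rpow_neg_one,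
      Real.rpow_neg hs.le, Real.sqrt_eq_rpow]
  have hss : 0 < Real.sqrt (Real.sin t) := Real.sqrt_pos.2 hs
  have hpos : 0 < Real.sin t ^ (-(3 : ℝ) / 2) := Real.rpow_pos_of_pos hs _
  calc _ ≤ (2 * Real.sqrt (r₁ * r₂) * Real.sin t)⁻¹ *
        (C * (Real.sqrt (r₁ * r₂) / (2 * Real.sqrt (Real.sin t)))) := by gcongr
    _ = C * Real.sin t ^ (-(3 : ℝ) / 2) / 4 := by rw [hpow]; field_simp; norm_num
    _ ≤ C * Real.sin t ^ (-(3 : ℝ) / 2) := by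
        have := mul_pos hC0 hpos
        linarith
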